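/- arXiv:2503.08597 — 10 statements merged into one kernel-verified Lean document; each statement's English description precedes it below -/
import Mathlib

section
/- Same-marginals property for NS-assisted broadcast coding (Theorem 2): Let K ≥ 1 and n ≥ 1, let 𝒳, 𝒴_1,…,𝒴_K, ℳ_1,…,ℳ_K be finite nonempty sets, and let N, Ñ : 𝒳 → Δ(𝒴_1×⋯×𝒴_K) be two conditional pmfs (broadcast channels) with identical marginals, i.e. for every k ∈ [K], x ∈ 𝒳 and b ∈ 𝒴_k one has Σ_{y : y_k=b} N(y|x) = Σ_{y : y_k=b} Ñ(y|x). Let Z be any conditional pmf with input (w, y_1^{[n]},…,y_K^{[n]}) ∈ (ℳ_1×⋯×ℳ_K)×(𝒴_1^n×⋯×𝒴_K^n) and output (x^{[n]}, ŵ) ∈ 𝒳^n × (ℳ_1×⋯×ℳ_K), and suppose Z satisfies, for each k ∈ [K], the non-signaling marginal condition: the sum Σ_{ŵ_j : j≠k} Z(x^{[n]}, ŵ | w, y_1^{[n]},…,y_K^{[n]}) depends on (y_1^{[n]},…,y_K^{[n]}) only through y_k^{[n]} (i.e. it is unchanged if the y_j^{[n]} for j ≠ k are replaced by arbitrary other values).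 For a channel N define the probability of correct decoding of message k as P_k(N) = (∏_{j=1}^K |ℳ_j|)^{-1} · Σ_{w, x^{[n]}, y^{[n]}, ŵ : ŵ_k = w_k} Z(x^{[n]}, ŵ | w, y^{[n]}) · ∏_{τ=1}^n N(y^{(τ)} | x^{(τ)}). Then P_k(N) = P_k(Ñ) for every k ∈ [K]. -/
open Finset

/-- If `f` is constant on the fibres of `g`, then `∑ a, f a * p a` only depends on the
push-forward of the weight `p` along `g`. -/
theorem sum_mul_eq_sum_mul_of_fiber {α β R : Type*} [Fintype α] [Fintype β] [DecidableEq β]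
    [CommSemiring R] (g : α → β) (f p q : α → R) (hf : ∀ a a', g a = g a' → f a = f a')
    (hpq : ∀ b, (∑ a, if g a = b then p a else 0) = ∑ a, if g a = b then q a else 0) :
    ∑ a, f a * p a = ∑ a, f a * q a := by
  rw [← Finset.sum_fiberwise univ g, ← Finset.sum_fiberwise univ g (fun a => f a * q a)]
  refine Finset.sum_congr rfl fun b _ => ?_
  by_cases hb : ∃ a₀, g a₀ = b
  · obtain ⟨a₀, rfl⟩ := hb
    have factor (r : α → R) : ∑ a with g a = g a₀, f a * r a =
        f a₀ * ∑ a, if g a = g a₀ then r a else 0 := by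
      rw [← Finset.sum_filter, Finset.mul_sum]
      exact Finset.sum_congr rfl fun a ha => by rw [hf a a₀ (Finset.mem_filter.1 ha).2]
    rw [factor, factor, hpq]
  · have hempty : ({a | g a = b} : Finset α) = ∅ :=
      Finset.filter_eq_empty_iff.2 fun a _ ha => hb ⟨a, ha⟩
    simp [hempty]

/-- The `k`-th marginal of a product of weights on `∀ j, Y j` is the product of the `k`-th
marginals. -/
theorem sum_ite_prod_eq_prod_sum_ite {ι κ R : Type*} [Fintype ι] [DecidableEq ι] [Fintype κ]
    [DecidableEq κ] [CommSemiring R] {Y : κ → Type*} [∀ k, Fintype (Y k)]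
    [∀ k, DecidableEq (Y k)] (W : ι → (∀ j, Y j) → R) (k : κ) (s : ι → Y k) :
    (∑ y : ∀ j, ι → Y j, if y k = s then ∏ τ, W τ (fun j => y j τ) else 0) =
      ∏ τ, ∑ z : ∀ j, Y j, if z k = s τ then W τ z else 0 := by
  rw [Finset.prod_univ_sum, Fintype.piFinset_univ]
  refine Fintype.sum_equiv (Equiv.piComm fun j (_ : ι) => Y j) _ _ fun y => ?_
  rw [Finset.prod_ite_zero]
  simp [funext_iff, Equiv.piComm, Function.swap]

/-- **Same-marginals property for NS-assisted broadcast coding** (Theorem 2): if two `K`-user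
broadcast channels `N` and `N'` have identical marginals, then any non-signaling box `Z`
(used as an NS-assisted coding scheme over `n` channel uses) yields the same probability of
correct decoding of each message `k` on both channels. -/
theorem same_marginals_NS
    (K n : ℕ) (hK : 1 ≤ K) (hn : 1 ≤ n)
    (X : Type) [Fintype X] [Nonempty X]
    (Y : Fin K → Type) [∀ k, Fintype (Y k)] [∀ k, Nonempty (Y k)] [∀ k, DecidableEq (Y k)]
    (M : Fin K → Type) [∀ k, Fintype (M k)] [∀ k, Nonempty (M k)] [∀ k, DecidableEq (M k)]
    -- the two broadcast channels, as conditional pmfs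
    (N N' : X → (∀ k, Y k) → ℝ)
    (hN0 : ∀ x y, 0 ≤ N x y) (hN1 : ∀ x, ∑ y : ∀ k, Y k, N x y = 1)
    (hN'0 : ∀ x y, 0 ≤ N' x y) (hN'1 : ∀ x, ∑ y : ∀ k, Y k, N' x y = 1)
    -- identical marginals
    (hmarg : ∀ (k : Fin K) (x : X) (b : Y k),
      (∑ y : ∀ j, Y j, if y k = b then N x y else 0) =
        (∑ y : ∀ j, Y j, if y k = b then N' x y else 0))
    -- the box: a conditional pmf from (messages, output sequences) to (input sequence,
    -- decoded messages)
    (Z : ((∀ k, M k) × (∀ k, Fin n → Y k)) → ((Fin n → X) × (∀ k, M k)) → ℝ)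
    (hZ0 : ∀ i o, 0 ≤ Z i o)
    (hZ1 : ∀ i, ∑ o : (Fin n → X) × (∀ k, M k), Z i o = 1)
    -- non-signaling marginal condition: the marginal on (x, ŵ_k) depends on the output
    -- sequences only through the k-th one
    (hNS : ∀ (k : Fin K) (w : ∀ j, M j) (y y' : ∀ j, Fin n → Y j), y k = y' k →
      ∀ (x : Fin n → X) (v : M k),
        (∑ wh : ∀ j, M j, if wh k = v then Z (w, y) (x, wh) else 0) =
          (∑ wh : ∀ j, M j, if wh k = v then Z (w, y') (x, wh) else 0)) :
    -- conclusion: equal probability of correct decoding of each message k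
    ∀ k : Fin K,
      (∏ j : Fin K, (Fintype.card (M j) : ℝ))⁻¹ *
        (∑ w : ∀ j, M j, ∑ x : Fin n → X, ∑ y : ∀ j, Fin n → Y j, ∑ wh : ∀ j, M j,
          if wh k = w k then Z (w, y) (x, wh) * ∏ τ : Fin n, N (x τ) (fun j => y j τ)
          else 0) =
      (∏ j : Fin K, (Fintype.card (M j) : ℝ))⁻¹ *
        (∑ w : ∀ j, M j, ∑ x : Fin n → X, ∑ y : ∀ j, Fin n → Y j, ∑ wh : ∀ j, M j,
          if wh k = w k then Z (w, y) (x, wh) * ∏ τ : Fin n, N' (x τ) (fun j => y j τ)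
          else 0) := by
  intro k
  congr 1
  refine Finset.sum_congr rfl fun w _ => Finset.sum_congr rfl fun x _ => ?_
  simp only [← ite_zero_mul, ← Finset.sum_mul]
  refine sum_mul_eq_sum_mul_of_fiber (fun y : ∀ j, Fin n → Y j => y k) _ _ _
    (fun y y' h => hNS k w y y' h x (w k)) fun s => ?_
  rw [sum_ite_prod_eq_prod_sum_ite fun τ => N (x τ),
    sum_ite_prod_eq_prod_sum_ite fun τ => N' (x τ)]
  exact Finset.prod_congr rfl fun τ _ => hmarg k (x τ) (s τ)
end

section
/- Classical converse core inequality for the semi-deterministic toy broadcast channel over F_3 (Theorem 4, converse): Let (Ω,P) be a probability space, let X1, X2 : Ω → F_3 be random variables valued in the field with 3 elements, let U : Ω → S be a random variable valued in a finite set S, and let G : Ω → F_3 be uniform on F_3^× = {1,2} and independent of the triple (X1, X2, U). Then H[X1 | U] + I[U : G·X1 + X2 | G] ≤ (3/2)·log 3. -/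
open MeasureTheory ProbabilityTheory

/-- Shannon entropy (natural logarithm) of a finitely-valued random variable `X`. -/
noncomputable def shannonEntropy {Ω : Type*} [MeasurableSpace Ω] (μ : Measure Ω)
    {A : Type*} [Fintype A] (X : Ω → A) : ℝ :=
  ∑ a : A, Real.negMulLog (μ (X ⁻¹' {a})).toReal

/-- Conditional Shannon entropy `H[X | Y] = ∑ b, P[Y = b] · H[X | Y = b]`. -/
noncomputable def condShannonEntropy {Ω : Type*} [MeasurableSpace Ω] (μ : Measure Ω)
    {A B : Type*} [Fintype A] [Fintype B] (X : Ω → A) (Y : Ω → B) : ℝ :=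
  ∑ b : B, (μ (Y ⁻¹' {b})).toReal *
    shannonEntropy (ProbabilityTheory.cond μ (Y ⁻¹' {b})) X

/-- Mutual information `I[X : Y] = H[X] + H[Y] - H[(X, Y)]`. -/
noncomputable def mutualInfoRV {Ω : Type*} [MeasurableSpace Ω] (μ : Measure Ω)
    {A B : Type*} [Fintype A] [Fintype B] (X : Ω → A) (Y : Ω → B) : ℝ :=
  shannonEntropy μ X + shannonEntropy μ Y - shannonEntropy μ (fun ω => (X ω, Y ω))

/-- Conditional mutual information `I[X : Y | Z] = ∑ c, P[Z = c] · I[X : Y | Z = c]`. -/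
noncomputable def condMutualInfoRV {Ω : Type*} [MeasurableSpace Ω] (μ : Measure Ω)
    {A B C : Type*} [Fintype A] [Fintype B] [Fintype C]
    (X : Ω → A) (Y : Ω → B) (Z : Ω → C) : ℝ :=
  ∑ c : C, (μ (Z ⁻¹' {c})).toReal *
    mutualInfoRV (ProbabilityTheory.cond μ (Z ⁻¹' {c})) X Y

theorem negMulLog_le_of_support {p q : ℝ} (hp : 0 ≤ p) (hq : 0 ≤ q) (hpq : q = 0 → p = 0) :
    Real.negMulLog p ≤ -(p * Real.log q) + q - p := by
  rcases hp.eq_or_lt with rfl | hp'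
  · simpa using hq
  · have hq' : 0 < q := lt_of_le_of_ne hq fun h => hp'.ne' (hpq h.symm)
    have h := mul_le_mul_of_nonneg_left (Real.log_le_sub_one_of_pos (div_pos hq' hp')) hp
    rw [Real.log_div hq'.ne' hp'.ne', mul_sub, mul_sub, mul_div_cancel₀ _ hp'.ne'] at h
    rw [Real.negMulLog]
    linarith

/-- Gibbs' inequality. -/
theorem sum_negMulLog_le_crossEntropy {A : Type*} [Fintype A] {p q : A → ℝ}
    (hp : ∀ a, 0 ≤ p a) (hq : ∀ a, 0 ≤ q a) (hpq : ∀ a, q a = 0 → p a = 0)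
    (hsum : ∑ a, q a ≤ ∑ a, p a) :
    ∑ a, Real.negMulLog (p a) ≤ -∑ a, p a * Real.log (q a) := by
  have h := Finset.sum_le_sum fun a (_ : a ∈ Finset.univ) =>
    negMulLog_le_of_support (hp a) (hq a) (hpq a)
  rw [Finset.sum_sub_distrib, Finset.sum_add_distrib, Finset.sum_neg_distrib] at h
  linarith

theorem negMulLog_sum_le {A : Type*} (s : Finset A) {p : A → ℝ} (hp : ∀ a, 0 ≤ p a) :
    Real.negMulLog (∑ a ∈ s, p a) ≤ ∑ a ∈ s, Real.negMulLog (p a) := by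
  rw [Real.negMulLog, neg_mul, Finset.sum_mul, ← Finset.sum_neg_distrib]
  refine Finset.sum_le_sum fun a ha => ?_
  rcases (hp a).eq_or_lt with h | h
  · simp [← h]
  · have := mul_le_mul_of_nonneg_left
      (Real.log_le_log h (Finset.single_le_sum (fun b _ => hp b) ha)) (hp a)
    rw [Real.negMulLog]
    linarith

theorem toReal_preimage_pair_le_left {Ω A B : Type*} [MeasurableSpace Ω] (μ : Measure Ω)
    [IsFiniteMeasure μ] (X : Ω → A) (Y : Ω → B) (a : A) (b : B) :
    (μ ((fun ω => (X ω, Y ω)) ⁻¹' {(a, b)})).toReal ≤ (μ (X ⁻¹' {a})).toReal :=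
  ENNReal.toReal_mono (measure_ne_top _ _) (measure_mono fun ω h => by simp_all)

theorem toReal_preimage_pair_le_right {Ω A B : Type*} [MeasurableSpace Ω] (μ : Measure Ω)
    [IsFiniteMeasure μ] (X : Ω → A) (Y : Ω → B) (a : A) (b : B) :
    (μ ((fun ω => (X ω, Y ω)) ⁻¹' {(a, b)})).toReal ≤ (μ (Y ⁻¹' {b})).toReal :=
  ENNReal.toReal_mono (measure_ne_top _ _) (measure_mono fun ω h => by simp_all)

section Entropy

variable {Ω : Type*} [MeasurableSpace Ω] [DiscreteMeasurableSpace Ω]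
  {A B : Type*} [Fintype A]

open Classical in
theorem toReal_preimage_singleton_comp (μ : Measure Ω) [IsFiniteMeasure μ] (X : Ω → A)
    (f : A → B) (b : B) :
    (μ ((fun ω => f (X ω)) ⁻¹' {b})).toReal =
      ∑ a with f a = b, (μ (X ⁻¹' {a})).toReal := by
  have h := sum_measureReal_preimage_singleton (μ := μ) (f := X)
    (Finset.univ.filter fun a => f a = b) (fun _ _ => .of_discrete)
  simp only [measureReal_def] at h
  rw [h]
  congr 2
  ext ω
  simp

theorem sum_toReal_preimage_singleton (μ : Measure Ω) [IsProbabilityMeasure μ] (X : Ω → A) :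
    ∑ a, (μ (X ⁻¹' {a})).toReal = 1 := by
  have h := sum_measureReal_preimage_singleton (μ := μ) (f := X) Finset.univ
    (fun _ _ => .of_discrete)
  simpa [measureReal_def] using h

variable [Fintype B]

theorem sum_toReal_pair_right (μ : Measure Ω) [IsFiniteMeasure μ] (X : Ω → A)
    (Y : Ω → B) (a : A) :
    ∑ b, (μ ((fun ω => (X ω, Y ω)) ⁻¹' {(a, b)})).toReal = (μ (X ⁻¹' {a})).toReal := by
  classical
  rw [toReal_preimage_singleton_comp μ (fun ω => (X ω, Y ω)) Prod.fst a, Finset.sum_filter,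
    Fintype.sum_prod_type_right]
  simp

theorem sum_toReal_pair_left (μ : Measure Ω) [IsFiniteMeasure μ]
    (X : Ω → A) (Y : Ω → B) (b : B) :
    ∑ a, (μ ((fun ω => (X ω, Y ω)) ⁻¹' {(a, b)})).toReal = (μ (Y ⁻¹' {b})).toReal := by
  classical
  rw [toReal_preimage_singleton_comp μ (fun ω => (X ω, Y ω)) Prod.snd b, Finset.sum_filter,
    Fintype.sum_prod_type]
  simp

theorem shannonEntropy_comp_le (μ : Measure Ω) [IsFiniteMeasure μ] (X : Ω → A) (f : A → B) :
    shannonEntropy μ (fun ω => f (X ω)) ≤ shannonEntropy μ X := by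
  classical
  unfold shannonEntropy
  rw [← Finset.sum_fiberwise Finset.univ f]
  refine Finset.sum_le_sum fun b _ => ?_
  rw [toReal_preimage_singleton_comp]
  exact (negMulLog_sum_le _ fun _ => ENNReal.toReal_nonneg).trans_eq (by congr)

theorem shannonEntropy_le_log_card (μ : Measure Ω) [IsProbabilityMeasure μ] [Nonempty A]
    (X : Ω → A) : shannonEntropy μ X ≤ Real.log (Fintype.card A) := by
  have hc : (Fintype.card A : ℝ) ≠ 0 := by exact_mod_cast Fintype.card_ne_zero
  refine (sum_negMulLog_le_crossEntropy (q := fun _ => (Fintype.card A : ℝ)⁻¹)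
    (fun _ => ENNReal.toReal_nonneg) (fun _ => by positivity)
    (fun a h => absurd h (inv_ne_zero hc)) ?_).trans_eq ?_
  · rw [sum_toReal_preimage_singleton]
    simp [hc]
  · rw [← Finset.sum_mul, sum_toReal_preimage_singleton, Real.log_inv]
    ring

theorem shannonEntropy_pair_le_add (μ : Measure Ω) [IsProbabilityMeasure μ] (X : Ω → A)
    (Y : Ω → B) :
    shannonEntropy μ (fun ω => (X ω, Y ω)) ≤ shannonEntropy μ X + shannonEntropy μ Y := by
  refine (sum_negMulLog_le_crossEntropy
    (q := fun z : A × B => (μ (X ⁻¹' {z.1})).toReal * (μ (Y ⁻¹' {z.2})).toReal)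
    (fun _ => ENNReal.toReal_nonneg) (fun _ => by positivity) ?_ ?_).trans_eq ?_
  · rintro ⟨a, b⟩ h
    rcases mul_eq_zero.1 h with h | h
    · exact le_antisymm (h ▸ toReal_preimage_pair_le_left μ X Y a b) ENNReal.toReal_nonneg
    · exact le_antisymm (h ▸ toReal_preimage_pair_le_right μ X Y a b) ENNReal.toReal_nonneg
  · rw [sum_toReal_preimage_singleton, Fintype.sum_prod_type]
    simp [← Finset.mul_sum, sum_toReal_preimage_singleton]
  · have key : ∀ z : A × B, (μ ((fun ω => (X ω, Y ω)) ⁻¹' {z})).toReal *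
        Real.log ((μ (X ⁻¹' {z.1})).toReal * (μ (Y ⁻¹' {z.2})).toReal) =
        (μ ((fun ω => (X ω, Y ω)) ⁻¹' {z})).toReal * Real.log (μ (X ⁻¹' {z.1})).toReal +
        (μ ((fun ω => (X ω, Y ω)) ⁻¹' {z})).toReal * Real.log (μ (Y ⁻¹' {z.2})).toReal := by
      rintro ⟨a, b⟩
      rcases (ENNReal.toReal_nonneg (a := μ ((fun ω => (X ω, Y ω)) ⁻¹' {(a, b)}))).eq_or_lt
        with h | h
      · simp [← h]
      · rw [Real.log_mul (h.trans_le (toReal_preimage_pair_le_left μ X Y a b)).ne'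
          (h.trans_le (toReal_preimage_pair_le_right μ X Y a b)).ne', mul_add]
    rw [Finset.sum_congr rfl fun z _ => key z, Finset.sum_add_distrib, Fintype.sum_prod_type,
      Fintype.sum_prod_type_right]
    simp only [← Finset.sum_mul, sum_toReal_pair_right,
      sum_toReal_pair_left]
    simp only [shannonEntropy, Real.negMulLog, neg_mul, Finset.sum_neg_distrib]
    ring

/-- Chain rule. -/
theorem shannonEntropy_pair_eq_add_cond (μ : Measure Ω) [IsProbabilityMeasure μ] (X : Ω → A)
    (Y : Ω → B) :
    shannonEntropy μ (fun ω => (X ω, Y ω)) = shannonEntropy μ X + condShannonEntropy μ Y X := by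
  unfold condShannonEntropy
  rw [shannonEntropy, Fintype.sum_prod_type, shannonEntropy, ← Finset.sum_add_distrib]
  refine Finset.sum_congr rfl fun a _ => ?_
  by_cases h : μ (X ⁻¹' {a}) = 0
  · have h0 : ∀ b, (μ ((fun ω => (X ω, Y ω)) ⁻¹' {(a, b)})).toReal = 0 := fun b =>
      le_antisymm (by simpa [h] using toReal_preimage_pair_le_left μ X Y a b)
        ENNReal.toReal_nonneg
    simp [h, h0]
  · have := cond_isProbabilityMeasure h
    have hm : ∀ b, (μ ((fun ω => (X ω, Y ω)) ⁻¹' {(a, b)})).toReal =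
        (μ (X ⁻¹' {a})).toReal * (μ[|X ⁻¹' {a}] (Y ⁻¹' {b})).toReal := fun b => by
      rw [← ENNReal.toReal_mul, mul_comm, cond_mul_eq_inter .of_discrete]
      congr 2
      ext ω
      simp
    simp only [hm, Real.negMulLog_mul, Finset.sum_add_distrib, ← Finset.sum_mul,
      ← Finset.mul_sum, sum_toReal_preimage_singleton, one_mul, shannonEntropy]

theorem mutualInfoRV_eq_sub_cond (μ : Measure Ω) [IsProbabilityMeasure μ] (X : Ω → A)
    (Y : Ω → B) :
    mutualInfoRV μ X Y = shannonEntropy μ Y - condShannonEntropy μ Y X := by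
  rw [mutualInfoRV, shannonEntropy_pair_eq_add_cond]
  ring

/-- Mutual information depends only on the joint law. -/
theorem mutualInfoRV_congr {μ ν : Measure Ω} [IsFiniteMeasure μ] [IsFiniteMeasure ν]
    {X X' : Ω → A} {Y Y' : Ω → B}
    (h : ∀ a b, μ ((fun ω => (X ω, Y ω)) ⁻¹' {(a, b)}) =
      ν ((fun ω => (X' ω, Y' ω)) ⁻¹' {(a, b)})) :
    mutualInfoRV μ X Y = mutualInfoRV ν X' Y' := by
  have hX : ∀ a, (μ (X ⁻¹' {a})).toReal = (ν (X' ⁻¹' {a})).toReal := fun a => by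
    rw [← sum_toReal_pair_right μ X Y,
      ← sum_toReal_pair_right ν X' Y']
    simp only [h]
  have hY : ∀ b, (μ (Y ⁻¹' {b})).toReal = (ν (Y' ⁻¹' {b})).toReal := fun b => by
    rw [← sum_toReal_pair_left μ X Y,
      ← sum_toReal_pair_left ν X' Y']
    simp only [h]
  simp only [mutualInfoRV, shannonEntropy, hX, hY, Fintype.sum_prod_type, h]

theorem mutualInfoRV_cond_of_indep {C D : Type*} [Fintype D] (μ : Measure Ω)
    [IsProbabilityMeasure μ] (G : Ω → C) (T : Ω → D) (g : C) (hg : μ (G ⁻¹' {g}) ≠ 0)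
    (hindep : ∀ t, μ (G ⁻¹' {g} ∩ T ⁻¹' {t}) = μ (G ⁻¹' {g}) * μ (T ⁻¹' {t}))
    (e : D → A) (f : C → D → B) :
    mutualInfoRV μ[|G ⁻¹' {g}] (fun ω => e (T ω)) (fun ω => f (G ω) (T ω)) =
      mutualInfoRV μ (fun ω => e (T ω)) (fun ω => f g (T ω)) := by
  have := cond_isProbabilityMeasure hg
  have hT : ∀ t, μ[|G ⁻¹' {g}] (T ⁻¹' {t}) = μ (T ⁻¹' {t}) := fun t => by
    rw [cond_apply .of_discrete, hindep, ← mul_assoc,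
      ENNReal.inv_mul_cancel hg (measure_ne_top _ _), one_mul]
  refine mutualInfoRV_congr fun a b => ?_
  have h1 : μ[|G ⁻¹' {g}] ((fun ω => (e (T ω), f (G ω) (T ω))) ⁻¹' {(a, b)}) =
      μ[|G ⁻¹' {g}] ((fun ω => (e (T ω), f g (T ω))) ⁻¹' {(a, b)}) := by
    rw [cond_apply .of_discrete, cond_apply .of_discrete]
    congr 2
    ext ω
    simp +contextual
  rw [h1, ← ENNReal.toReal_eq_toReal_iff' (measure_ne_top _ _) (measure_ne_top _ _),
    toReal_preimage_singleton_comp _ T (fun t => (e t, f g t)),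
    toReal_preimage_singleton_comp _ T (fun t => (e t, f g t))]
  simp only [hT]

/-- `X1` is recovered from the two channel outputs `X1 + X2` and `2 * X1 + X2`. -/
theorem shannonEntropy_sub_half_outputs_le (μ : Measure Ω) [IsProbabilityMeasure μ]
    (X1 X2 : Ω → ZMod 3) :
    shannonEntropy μ X1 - 1 / 2 * (shannonEntropy μ (fun ω => 1 * X1 ω + X2 ω) +
      shannonEntropy μ (fun ω => 2 * X1 ω + X2 ω)) ≤ 1 / 2 * Real.log 3 := by
  have h1 := shannonEntropy_comp_le μ (fun ω => (1 * X1 ω + X2 ω, 2 * X1 ω + X2 ω))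
    fun z => z.2 - z.1
  have h2 := shannonEntropy_pair_le_add μ (fun ω => 1 * X1 ω + X2 ω) fun ω => 2 * X1 ω + X2 ω
  have h3 := shannonEntropy_le_log_card μ X1
  have h4 : (fun ω => 2 * X1 ω + X2 ω - (1 * X1 ω + X2 ω)) = X1 := by
    ext ω
    ring_nf
  simp only [h4] at h1
  rw [ZMod.card] at h3
  push_cast at h3
  linarith

theorem condShannonEntropy_sub_half_outputs_le (μ : Measure Ω) [IsProbabilityMeasure μ]
    (X1 X2 : Ω → ZMod 3) (U : Ω → A) :
    condShannonEntropy μ X1 U - 1 / 2 * (condShannonEntropy μ (fun ω => 1 * X1 ω + X2 ω) U +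
      condShannonEntropy μ (fun ω => 2 * X1 ω + X2 ω) U) ≤ 1 / 2 * Real.log 3 := by
  calc _ = ∑ u, (μ (U ⁻¹' {u})).toReal * (shannonEntropy μ[|U ⁻¹' {u}] X1 -
          1 / 2 * (shannonEntropy μ[|U ⁻¹' {u}] (fun ω => 1 * X1 ω + X2 ω) +
          shannonEntropy μ[|U ⁻¹' {u}] (fun ω => 2 * X1 ω + X2 ω))) := by
        simp only [condShannonEntropy, ← Finset.sum_add_distrib, Finset.mul_sum,
          ← Finset.sum_sub_distrib]
        exact Finset.sum_congr rfl fun u _ => by ring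
    _ ≤ ∑ u, (μ (U ⁻¹' {u})).toReal * (1 / 2 * Real.log 3) := by
        refine Finset.sum_le_sum fun u _ => ?_
        by_cases h : μ (U ⁻¹' {u}) = 0
        · simp [h]
        · have := cond_isProbabilityMeasure h
          exact mul_le_mul_of_nonneg_left (shannonEntropy_sub_half_outputs_le _ X1 X2)
            ENNReal.toReal_nonneg
    _ = _ := by rw [← Finset.sum_mul, sum_toReal_preimage_singleton, one_mul]

end Entropy

/-- **Classical converse core inequality for the semi-deterministic toy BC over `F_3`**
(Theorem 4, converse): if `G` is uniform on `F_3^× = {1,2}` and independent of `(X1, X2, U)`,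
then `H[X1 | U] + I[U : G·X1 + X2 | G] ≤ (3/2)·log 3`. -/
theorem toy1_F3_converse_core
    {Ω : Type*} [Fintype Ω] [MeasurableSpace Ω] [MeasurableSingletonClass Ω]
    (μ : Measure Ω) [IsProbabilityMeasure μ]
    {S : Type*} [Fintype S]
    (X1 X2 : Ω → ZMod 3) (U : Ω → S) (G : Ω → ZMod 3)
    (hG : ∀ g : ZMod 3, μ (G ⁻¹' {g}) = if g = 0 then 0 else 1 / 2)
    (hindep : ∀ (g x1 x2 : ZMod 3) (u : S),
      μ (G ⁻¹' {g} ∩ (fun ω => (X1 ω, X2 ω, U ω)) ⁻¹' {(x1, x2, u)}) =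
        μ (G ⁻¹' {g}) * μ ((fun ω => (X1 ω, X2 ω, U ω)) ⁻¹' {(x1, x2, u)})) :
    condShannonEntropy μ X1 U +
      condMutualInfoRV μ U (fun ω => G ω * X1 ω + X2 ω) G ≤ (3 / 2) * Real.log 3 := by
  have hI : ∀ g : ZMod 3, g ≠ 0 →
      mutualInfoRV μ[|G ⁻¹' {g}] U (fun ω => G ω * X1 ω + X2 ω) ≤
        Real.log 3 - condShannonEntropy μ (fun ω => g * X1 ω + X2 ω) U := fun g hg => by
    have h := mutualInfoRV_cond_of_indep μ G (fun ω => (X1 ω, X2 ω, U ω)) g (by simp [hG, hg])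
      (fun t => hindep g t.1 t.2.1 t.2.2) (fun t => t.2.2) (fun c t => c * t.1 + t.2.1)
    have hlog := shannonEntropy_le_log_card μ fun ω => g * X1 ω + X2 ω
    rw [ZMod.card] at hlog
    push_cast at hlog
    rw [h, mutualInfoRV_eq_sub_cond]
    linarith
  have huniv : (Finset.univ : Finset (ZMod 3)) = {0, 1, 2} := by decide
  have hsum : condMutualInfoRV μ U (fun ω => G ω * X1 ω + X2 ω) G =
      1 / 2 * (mutualInfoRV μ[|G ⁻¹' {1}] U (fun ω => G ω * X1 ω + X2 ω) +
        mutualInfoRV μ[|G ⁻¹' {2}] U (fun ω => G ω * X1 ω + X2 ω)) := by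
    have h2 : (2 : ZMod 3) ≠ 0 := by decide
    rw [condMutualInfoRV, huniv, Finset.sum_insert (by decide), Finset.sum_insert (by decide),
      Finset.sum_singleton, hG, hG, hG]
    simp [h2]
    ring
  have h1 := hI 1 (by decide)
  have h2 := hI 2 (by decide)
  have h3 := condShannonEntropy_sub_half_outputs_le μ X1 X2 U
  rw [hsum]
  linarith
end

section
/- Achievability computation for the semi-deterministic toy broadcast channel over F_3 (Theorem 4, achievability): Let W1, W2 : Ω → F_3 be independent random variables, each uniform on F_3, and let G : Ω → F_3 be uniform on F_3^× = {1,2} and independent of the pair (W1, W2). Then I[W2 : G·W1 + (W2 − W1) | G] = (1/2)·log 3. -/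
open MeasureTheory ProbabilityTheory

/-- If every fibre of `V` has the same probability, the probability of an event depending on `V`
is the normalized counting measure. -/
theorem toReal_preimage_comp_of_uniform {Ω U A : Type*} [MeasurableSpace Ω]
    [DiscreteMeasurableSpace Ω] (ν : Measure Ω) [IsFiniteMeasure ν] [Fintype U] [DecidableEq A]
    (V : Ω → U) (f : U → A) (q : ℝ) (hV : ∀ u, (ν (V ⁻¹' {u})).toReal = q) (a : A) :
    (ν ((fun ω => f (V ω)) ⁻¹' {a})).toReal =
      ((Finset.univ.filter fun u => f u = a).card : ℝ) * q := by
  have hset : (fun ω => f (V ω)) ⁻¹' {a} =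
      ⋃ u ∈ Finset.univ.filter (fun u => f u = a), V ⁻¹' {u} := by
    ext ω
    simp
  rw [hset, measure_biUnion_finset, ENNReal.toReal_sum]
  · simp [hV]
  · exact fun u _ => measure_ne_top _ _
  · intro u _ v _ huv
    exact Disjoint.preimage V (by simpa using huv)
  · exact fun u _ => MeasurableSet.of_discrete

/-- A function of a uniform variable whose nonempty fibres all have `k` elements is uniform on its
range, so its entropy is `log (|U| / k)`. -/
theorem shannonEntropy_comp_of_uniform {Ω U A : Type*} [MeasurableSpace Ω]
    [DiscreteMeasurableSpace Ω] (ν : Measure Ω) [IsFiniteMeasure ν] [Fintype U] [Nonempty U]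
    [Fintype A] [DecidableEq A] (V : Ω → U) (f : U → A)
    (hV : ∀ u, (ν (V ⁻¹' {u})).toReal = (Fintype.card U : ℝ)⁻¹) (k : ℕ)
    (hk : ∀ a, (Finset.univ.filter fun u => f u = a).card = 0 ∨
      (Finset.univ.filter fun u => f u = a).card = k) :
    shannonEntropy ν (fun ω => f (V ω)) = Real.log (Fintype.card U / k) := by
  have hU : (Fintype.card U : ℝ) ≠ 0 := by exact_mod_cast Fintype.card_ne_zero
  have hterm : ∀ a, Real.negMulLog (ν ((fun ω => f (V ω)) ⁻¹' {a})).toReal =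
      ((Finset.univ.filter fun u => f u = a).card : ℝ) *
        ((Fintype.card U : ℝ)⁻¹ * Real.log (Fintype.card U / k)) := by
    intro a
    rw [toReal_preimage_comp_of_uniform ν V f _ hV a]
    rcases hk a with h | h
    · simp [h]
    · rw [h, Real.negMulLog, ← inv_div (k : ℝ), Real.log_inv, div_eq_mul_inv]
      ring
  have hcard : ∑ a, ((Finset.univ.filter fun u => f u = a).card : ℝ) = Fintype.card U := by
    rw [← Finset.card_univ,
      Finset.card_eq_sum_card_fiberwise (f := f) (t := Finset.univ) (by simp)]
    push_cast
    rfl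
  rw [shannonEntropy, Finset.sum_congr rfl fun a _ => hterm a, ← Finset.sum_mul, hcard,
    mul_inv_cancel_left₀ hU]

/-- Mutual information of two functions of a uniform variable, each with balanced fibres. -/
theorem mutualInfoRV_comp_of_uniform {Ω U A B : Type*} [MeasurableSpace Ω]
    [DiscreteMeasurableSpace Ω] (ν : Measure Ω) [IsFiniteMeasure ν] [Fintype U] [Nonempty U]
    [Fintype A] [DecidableEq A] [Fintype B] [DecidableEq B] (V : Ω → U) (f : U → A) (g : U → B)
    (hV : ∀ u, (ν (V ⁻¹' {u})).toReal = (Fintype.card U : ℝ)⁻¹) (k l m : ℕ)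
    (hk : ∀ a, (Finset.univ.filter fun u => f u = a).card = 0 ∨
      (Finset.univ.filter fun u => f u = a).card = k)
    (hl : ∀ b, (Finset.univ.filter fun u => g u = b).card = 0 ∨
      (Finset.univ.filter fun u => g u = b).card = l)
    (hm : ∀ c, (Finset.univ.filter fun u => (f u, g u) = c).card = 0 ∨
      (Finset.univ.filter fun u => (f u, g u) = c).card = m) :
    mutualInfoRV ν (fun ω => f (V ω)) (fun ω => g (V ω)) =
      Real.log (Fintype.card U / k) + Real.log (Fintype.card U / l) -
        Real.log (Fintype.card U / m) := by
  rw [mutualInfoRV, shannonEntropy_comp_of_uniform ν V f hV k hk,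
    shannonEntropy_comp_of_uniform ν V g hV l hl,
    shannonEntropy_comp_of_uniform ν V (fun u => (f u, g u)) hV m hm]

/-- After conditioning on `s`, mutual information only depends on the values of the second variable
on `s`. -/
theorem mutualInfoRV_cond_congr_right {Ω A B : Type*} [MeasurableSpace Ω]
    [DiscreteMeasurableSpace Ω] (μ : Measure Ω) [Fintype A] [Fintype B] (s : Set Ω)
    (X : Ω → A) {Y Y' : Ω → B} (h : ∀ ω ∈ s, Y ω = Y' ω) :
    mutualInfoRV (ProbabilityTheory.cond μ s) X Y =
      mutualInfoRV (ProbabilityTheory.cond μ s) X Y' := by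
  have key : ∀ t t' : Set Ω, (∀ ω ∈ s, ω ∈ t ↔ ω ∈ t') →
      ProbabilityTheory.cond μ s t = ProbabilityTheory.cond μ s t' := by
    intro t t' htt'
    rw [cond_apply MeasurableSet.of_discrete, cond_apply MeasurableSet.of_discrete]
    congr 2
    ext ω
    exact and_congr_right (htt' ω)
  have hY : ∀ b, ProbabilityTheory.cond μ s (Y ⁻¹' {b}) =
      ProbabilityTheory.cond μ s (Y' ⁻¹' {b}) :=
    fun b => key _ _ fun ω hω => by simp [h ω hω]
  have hXY : ∀ c, ProbabilityTheory.cond μ s ((fun ω => (X ω, Y ω)) ⁻¹' {c}) =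
      ProbabilityTheory.cond μ s ((fun ω => (X ω, Y' ω)) ⁻¹' {c}) :=
    fun c => key _ _ fun ω hω => by simp [h ω hω]
  simp only [mutualInfoRV, shannonEntropy, hY, hXY]

/-- **Achievability computation for the semi-deterministic toy BC over `F_3`**
(Theorem 4, achievability): if `W1, W2` are independent uniform on `F_3`, and `G` is uniform on
`F_3^× = {1,2}` independent of `(W1, W2)`, then
`I[W2 : G·W1 + (W2 − W1) | G] = (1/2)·log 3`. -/
theorem toy1_F3_achievability_core
    {Ω : Type*} [Fintype Ω] [MeasurableSpace Ω] [MeasurableSingletonClass Ω]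
    (μ : Measure Ω) [IsProbabilityMeasure μ]
    (W1 W2 : Ω → ZMod 3) (G : Ω → ZMod 3)
    (hjoint : ∀ g a b : ZMod 3,
      μ ((fun ω => (G ω, W1 ω, W2 ω)) ⁻¹' {(g, a, b)}) =
        (if g = 0 then 0 else 1 / 2) * ((1 / 3) * (1 / 3))) :
    condMutualInfoRV μ W2 (fun ω => G ω * W1 ω + (W2 ω - W1 ω)) G =
      (1 / 2) * Real.log 3 := by
  have hT : ∀ g, (μ (G ⁻¹' {g})).toReal = if g = 0 then 0 else 1 / 2 := by
    intro g
    have hset : G ⁻¹' {g} = ⋃ p ∈ (Finset.univ : Finset (ZMod 3 × ZMod 3)),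
        (fun ω => (G ω, W1 ω, W2 ω)) ⁻¹' {(g, p)} := by
      ext ω
      simp [Prod.ext_iff]
    rw [hset, measure_biUnion_finset, ENNReal.toReal_sum]
    · rw [Fintype.sum_congr _ (fun _ => (if g = 0 then 0 else 1 / 2) * ((1 / 3) * (1 / 3) : ℝ))]
      · simp
        split_ifs <;> norm_num
      · rintro ⟨a, b⟩
        rw [hjoint]
        split_ifs <;> simp
    · exact fun p _ => measure_ne_top _ _
    · intro p _ q _ hpq
      exact Disjoint.preimage _ (by simpa using hpq)
    · exact fun p _ => MeasurableSet.of_discrete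
  have hV : ∀ g, g ≠ 0 → ∀ p : ZMod 3 × ZMod 3,
      (ProbabilityTheory.cond μ (G ⁻¹' {g}) ((fun ω => (W1 ω, W2 ω)) ⁻¹' {p})).toReal =
        (Fintype.card (ZMod 3 × ZMod 3) : ℝ)⁻¹ := by
    rintro g hg ⟨a, b⟩
    have hset : G ⁻¹' {g} ∩ (fun ω => (W1 ω, W2 ω)) ⁻¹' {(a, b)} =
        (fun ω => (G ω, W1 ω, W2 ω)) ⁻¹' {(g, a, b)} := by
      ext ω
      simp
    rw [cond_apply MeasurableSet.of_discrete, hset, hjoint, ENNReal.toReal_mul,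
      ENNReal.toReal_inv, hT]
    simp [hg, ZMod.card]
    norm_num
  have h1 : mutualInfoRV (ProbabilityTheory.cond μ (G ⁻¹' {1})) W2
      (fun ω => G ω * W1 ω + (W2 ω - W1 ω)) = Real.log 3 := by
    rw [mutualInfoRV_cond_congr_right μ (G ⁻¹' {1}) W2 (Y := fun ω => G ω * W1 ω + (W2 ω - W1 ω))
      (Y' := fun ω => 1 * W1 ω + (W2 ω - W1 ω)) (fun ω hω => by
        rw [Set.mem_preimage, Set.mem_singleton_iff] at hω
        simp only [hω])]
    have := mutualInfoRV_comp_of_uniform _ (fun ω => (W1 ω, W2 ω)) (fun p => p.2)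
      (fun p => 1 * p.1 + (p.2 - p.1)) (hV 1 (by decide)) 3 3 3
      (by decide) (by decide) (by decide)
    rw [this]
    norm_num [ZMod.card]
  have h2 : mutualInfoRV (ProbabilityTheory.cond μ (G ⁻¹' {2})) W2
      (fun ω => G ω * W1 ω + (W2 ω - W1 ω)) = 0 := by
    rw [mutualInfoRV_cond_congr_right μ (G ⁻¹' {2}) W2 (Y := fun ω => G ω * W1 ω + (W2 ω - W1 ω))
      (Y' := fun ω => 2 * W1 ω + (W2 ω - W1 ω)) (fun ω hω => by
        rw [Set.mem_preimage, Set.mem_singleton_iff] at hω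
        simp only [hω])]
    have := mutualInfoRV_comp_of_uniform _ (fun ω => (W1 ω, W2 ω)) (fun p => p.2)
      (fun p => 2 * p.1 + (p.2 - p.1)) (hV 2 (by decide)) 3 3 1
      (by decide) (by decide) (by decide)
    have h9 : Real.log 9 = Real.log 3 + Real.log 3 := by
      rw [← Real.log_mul (by norm_num) (by norm_num)]
      norm_num
    rw [this]
    norm_num [ZMod.card, h9]
  have huniv : (Finset.univ : Finset (ZMod 3)) = {0, 1, 2} := by decide
  rw [condMutualInfoRV, huniv, Finset.sum_insert (by decide), Finset.sum_insert (by decide),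
    Finset.sum_singleton, h1, h2, hT, hT]
  simp
end

section
/- Two-coefficient entropy inequality (key step in the converse of Theorem 5): Let F be a finite field and let g, g' ∈ F with g ≠ g'. Let X1, X2 : Ω → F be random variables and U : Ω → S a random variable valued in a finite set S. Then H[g·X1 + X2 | U] + H[g'·X1 + X2 | U] ≥ H[(X1, X2) | U]. -/
open MeasureTheory ProbabilityTheory

/-- Subadditivity of entropy for a finite joint distribution `p`. -/
theorem sum_negMulLog_le_add_marginals {A B : Type*} [Fintype A] [Fintype B]
    (p : A × B → ℝ) (hp : ∀ x, 0 ≤ p x) (hsum : ∑ x, p x = 1) :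
    ∑ x, Real.negMulLog (p x) ≤
      ∑ a, Real.negMulLog (∑ b, p (a, b)) + ∑ b, Real.negMulLog (∑ a, p (a, b)) := by
  set q : A → ℝ := fun a => ∑ b, p (a, b)
  set r : B → ℝ := fun b => ∑ a, p (a, b)
  have hq0 : ∀ a, 0 ≤ q a := fun a => Finset.sum_nonneg fun b _ => hp _
  have hr0 : ∀ b, 0 ≤ r b := fun b => Finset.sum_nonneg fun a _ => hp _
  have hpq : ∀ a b, p (a, b) ≤ q a := fun a b =>
    Finset.single_le_sum (f := fun b => p (a, b)) (fun _ _ => hp _) (Finset.mem_univ b)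
  have hpr : ∀ a b, p (a, b) ≤ r b := fun a b =>
    Finset.single_le_sum (f := fun a => p (a, b)) (fun _ _ => hp _) (Finset.mem_univ a)
  have hq1 : ∑ a, q a = 1 := by rw [← hsum, Fintype.sum_prod_type]
  have hr1 : ∑ b, r b = 1 := by rw [← hsum, Fintype.sum_prod_type_right]
  have key : ∀ a b, Real.negMulLog (p (a, b)) ≤
      -(p (a, b) * Real.log (q a)) - p (a, b) * Real.log (r b) + (q a * r b - p (a, b)) := by
    intro a b
    rcases (hp (a, b)).eq_or_lt with h | h
    · simp only [← h, Real.negMulLog_zero]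
      have := mul_nonneg (hq0 a) (hr0 b)
      linarith
    · have h1 := h.trans_le (hpq a b)
      have h2 := h.trans_le (hpr a b)
      have h3 := mul_le_mul_of_nonneg_left
        (Real.log_le_sub_one_of_pos (div_pos (mul_pos h1 h2) h)) h.le
      rw [Real.log_div (mul_pos h1 h2).ne' h.ne', Real.log_mul h1.ne' h2.ne', mul_sub,
        mul_sub, mul_div_cancel₀ _ h.ne'] at h3
      rw [Real.negMulLog]
      linarith
  calc ∑ x, Real.negMulLog (p x) = ∑ a, ∑ b, Real.negMulLog (p (a, b)) :=
        Fintype.sum_prod_type _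
    _ ≤ ∑ a, ∑ b, (-(p (a, b) * Real.log (q a)) - p (a, b) * Real.log (r b) +
          (q a * r b - p (a, b))) :=
        Finset.sum_le_sum fun a _ => Finset.sum_le_sum fun b _ => key a b
    _ = ∑ a, Real.negMulLog (q a) + ∑ b, Real.negMulLog (r b) := by
        simp only [Finset.sum_add_distrib, Finset.sum_sub_distrib, Finset.sum_neg_distrib]
        rw [Finset.sum_comm (f := fun a b => p (a, b) * Real.log (r b))]
        simp only [← Finset.sum_mul, ← Finset.mul_sum, hr1, mul_one]
        change -∑ a, q a * Real.log (q a) - ∑ b, r b * Real.log (r b) +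
          (∑ a, q a - ∑ a, q a) = _
        simp only [Real.negMulLog, neg_mul, Finset.sum_neg_distrib]
        ring

/-- The fibres of a finitely-valued map partition the measure of a set. -/
theorem sum_measureReal_inter_fiber {Ω : Type*} [MeasurableSpace Ω] [DiscreteMeasurableSpace Ω]
    (μ : Measure Ω) [IsFiniteMeasure μ] {A : Type*} [Fintype A] (X : Ω → A) (s : Set Ω) :
    ∑ a, μ.real (s ∩ X ⁻¹' {a}) = μ.real s := by
  rw [← measureReal_biUnion_finset]
  · congr 1
    ext ω
    simp
  · intro a _ b _ hab
    exact Set.disjoint_left.2 fun ω h h' => hab (h.2.symm.trans h'.2)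
  · exact fun _ _ => .of_discrete

/-- Shannon entropy is subadditive. -/
theorem shannonEntropy_prodMk_le {Ω : Type*} [MeasurableSpace Ω] [DiscreteMeasurableSpace Ω]
    (μ : Measure Ω) [IsProbabilityMeasure μ] {A B : Type*} [Fintype A] [Fintype B]
    (X : Ω → A) (Y : Ω → B) :
    shannonEntropy μ (fun ω => (X ω, Y ω)) ≤ shannonEntropy μ X + shannonEntropy μ Y := by
  have pre (a : A) (b : B) :
      (fun ω => (X ω, Y ω)) ⁻¹' {(a, b)} = X ⁻¹' {a} ∩ Y ⁻¹' {b} := by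
    ext ω
    simp
  have hX (a : A) : ∑ b, μ.real ((fun ω => (X ω, Y ω)) ⁻¹' {(a, b)}) = μ.real (X ⁻¹' {a}) := by
    simp only [pre, sum_measureReal_inter_fiber]
  have hY (b : B) : ∑ a, μ.real ((fun ω => (X ω, Y ω)) ⁻¹' {(a, b)}) = μ.real (Y ⁻¹' {b}) := by
    simp only [pre, Set.inter_comm (X ⁻¹' _), sum_measureReal_inter_fiber]
  have h := sum_negMulLog_le_add_marginals
    (fun x : A × B => μ.real ((fun ω => (X ω, Y ω)) ⁻¹' {x}))
    (fun _ => measureReal_nonneg)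
    (by simpa using sum_measureReal_inter_fiber μ (fun ω => (X ω, Y ω)) Set.univ)
  simp only [hX, hY] at h
  exact h

/-- Shannon entropy is invariant under relabelling the values. -/
theorem shannonEntropy_equiv_comp {Ω : Type*} [MeasurableSpace Ω] (μ : Measure Ω)
    {A B : Type*} [Fintype A] [Fintype B] (e : A ≃ B) (X : Ω → A) :
    shannonEntropy μ (fun ω => e (X ω)) = shannonEntropy μ X := by
  refine (Fintype.sum_equiv e _ _ fun a => ?_).symm
  congr 3
  ext ω
  simp

/-- Two distinct slopes determine a pair of field elements. -/
theorem bijective_two_slopes {F : Type*} [Field F] [Finite F] {g g' : F} (h : g ≠ g') :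
    Function.Bijective (fun x : F × F => (g * x.1 + x.2, g' * x.1 + x.2)) := by
  refine Function.Injective.bijective_of_finite ?_
  rintro ⟨a, b⟩ ⟨c, d⟩ hx
  obtain ⟨h1, h2⟩ := Prod.mk.inj hx
  dsimp only at h1 h2
  have hac : a = c := mul_left_cancel₀ (sub_ne_zero.2 h) (by linear_combination h1 - h2)
  subst hac
  exact Prod.ext rfl (add_left_cancel h1)

/-- **Two-coefficient entropy inequality** (key step in the converse of Theorem 5): for a
finite field `F` and `g ≠ g'` in `F`,
`H[g·X1 + X2 | U] + H[g'·X1 + X2 | U] ≥ H[(X1, X2) | U]`. -/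
theorem two_coefficient_entropy_ineq
    {Ω : Type*} [Fintype Ω] [MeasurableSpace Ω] [MeasurableSingletonClass Ω]
    (μ : Measure Ω) [IsProbabilityMeasure μ]
    {F : Type*} [Field F] [Fintype F]
    {S : Type*} [Fintype S]
    (g g' : F) (hgg' : g ≠ g')
    (X1 X2 : Ω → F) (U : Ω → S) :
    condShannonEntropy μ (fun ω => (X1 ω, X2 ω)) U ≤
      condShannonEntropy μ (fun ω => g * X1 ω + X2 ω) U +
        condShannonEntropy μ (fun ω => g' * X1 ω + X2 ω) U := by
  rw [condShannonEntropy, condShannonEntropy, condShannonEntropy, ← Finset.sum_add_distrib]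
  refine Finset.sum_le_sum fun u _ => ?_
  rw [← mul_add]
  by_cases hu : μ (U ⁻¹' {u}) = 0
  · simp [hu]
  have := cond_isProbabilityMeasure hu
  refine mul_le_mul_of_nonneg_left ?_ ENNReal.toReal_nonneg
  rw [← shannonEntropy_equiv_comp _ (Equiv.ofBijective _ (bijective_two_slopes hgg'))]
  exact shannonEntropy_prodMk_le _ _ _
end

section
/- Finite-field aligned-images entropy bound (core of the classical DoF converse, Appendix C.1): Let F be a finite field, and let n ≥ 1, k ≥ 1. Let ψ_1,…,ψ_k : F^n → F^n be arbitrary functions and suppose there exists h : F^k → F such that h(ψ_1(y)_τ, …, ψ_k(y)_τ) = y_τ for every y ∈ F^n and every coordinate τ ∈ [n]. Let Y : Ω → F^n be any random variable, and let G = (G_{i,τ})_{i∈[k], τ∈[n]} be a family of mutually independent random variables, each uniform on F^×, with the whole family G independent of Y. Define Z : Ω → F^n coordinatewise by Z_τ = Σ_{i=1}^k G_{i,τ} · ψ_i(Y)_τ. Then H[Y | (Z, G)] ≤ n·log 2. -/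
open MeasureTheory ProbabilityTheory

/-- The real-valued probability mass function of the uniform distribution on `F^×`. -/
noncomputable def unitMass (F : Type*) [Field F] [Fintype F] [DecidableEq F] (a : F) : ℝ :=
  if a = 0 then 0 else ((Fintype.card F : ℝ) - 1)⁻¹

section FiniteProbability

variable {Ω : Type*} [Fintype Ω] [MeasurableSpace Ω] [MeasurableSingletonClass Ω]

lemma sum_real_inter_preimage_singleton (μ : Measure Ω) [IsFiniteMeasure μ]
    {A : Type*} [Fintype A] (X : Ω → A) (s : Set Ω) :
    ∑ a, μ.real (s ∩ X ⁻¹' {a}) = μ.real s := by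
  have hm : ∀ t : Set Ω, MeasurableSet t := fun t => t.toFinite.measurableSet
  have := sum_measureReal_preimage_singleton (μ := μ.restrict s) (f := X) Finset.univ
    (fun _ _ => hm _)
  simpa [measureReal_restrict_apply (hm _), Set.inter_comm] using this

lemma mul_negMulLog_div_le {p m C : ℝ} (hp : 0 ≤ p) (hpm : p ≤ m) (hC : 0 < C) :
    m * Real.negMulLog (p / m) ≤ p * Real.log C + (if p = 0 then 0 else m) / C - p := by
  rcases hp.eq_or_lt with rfl | hp
  · simp
  have hm : 0 < m := hp.trans_le hpm
  rw [if_neg hp.ne']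
  have hlog := Real.log_le_sub_one_of_pos (show 0 < m / p / C by positivity)
  rw [Real.log_div (by positivity) hC.ne', Real.log_div hm.ne' hp.ne'] at hlog
  rw [Real.negMulLog, Real.log_div hp.ne' hm.ne']
  calc m * (-(p / m) * (Real.log p - Real.log m))
      = p * (Real.log m - Real.log p) := by field_simp; ring
    _ ≤ p * (Real.log C + (m / p / C - 1)) := by gcongr; linarith
    _ = p * Real.log C + m / C - p := by field_simp; ring

/-- If `C` bounds the expected size of the conditional support of `X` given `B`, then
`H[X | B] ≤ log C`. -/
lemma condShannonEntropy_le_log (μ : Measure Ω) [IsProbabilityMeasure μ]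
    {A B : Type*} [Fintype A] [Fintype B] (X : Ω → A) (Y : Ω → B) {C : ℝ} (hC : 0 < C)
    (hsupp : ∑ b, ∑ a, (if μ.real (Y ⁻¹' {b} ∩ X ⁻¹' {a}) = 0 then 0 else μ.real (Y ⁻¹' {b})) ≤ C) :
    condShannonEntropy μ X Y ≤ Real.log C := by
  have hm : ∀ t : Set Ω, MeasurableSet t := fun t => t.toFinite.measurableSet
  have htotal : ∑ b, ∑ a, μ.real (Y ⁻¹' {b} ∩ X ⁻¹' {a}) = 1 := by
    simp_rw [sum_real_inter_preimage_singleton]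
    simpa using sum_real_inter_preimage_singleton μ Y Set.univ
  calc condShannonEntropy μ X Y
      = ∑ b, ∑ a, μ.real (Y ⁻¹' {b}) *
          Real.negMulLog (μ.real (Y ⁻¹' {b} ∩ X ⁻¹' {a}) / μ.real (Y ⁻¹' {b})) := by
        refine Finset.sum_congr rfl fun b _ => ?_
        rw [shannonEntropy, Finset.mul_sum]
        refine Finset.sum_congr rfl fun a _ => ?_
        rw [cond_apply (hm _), ENNReal.toReal_mul, ENNReal.toReal_inv, ← div_eq_inv_mul]
        rfl
    _ ≤ ∑ b, ∑ a, (μ.real (Y ⁻¹' {b} ∩ X ⁻¹' {a}) * Real.log C +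
          (if μ.real (Y ⁻¹' {b} ∩ X ⁻¹' {a}) = 0 then 0 else μ.real (Y ⁻¹' {b})) / C -
          μ.real (Y ⁻¹' {b} ∩ X ⁻¹' {a})) := by
        gcongr
        exact mul_negMulLog_div_le measureReal_nonneg
          (measureReal_mono Set.inter_subset_left) hC
    _ ≤ Real.log C := by
        simp_rw [Finset.sum_sub_distrib, Finset.sum_add_distrib, ← Finset.sum_mul,
          ← Finset.sum_div, htotal]
        have := (div_le_one hC).2 hsupp
        linarith

end FiniteProbability

section UnitMass

variable {F : Type*} [Field F] [Fintype F]

lemma card_sub_one_pos : 0 < (Fintype.card F : ℝ) - 1 := by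
  have : (1 : ℝ) < Fintype.card F := by exact_mod_cast Fintype.one_lt_card
  linarith

variable [DecidableEq F]

lemma unitMass_nonneg (a : F) : 0 ≤ unitMass F a := by
  have := card_sub_one_pos (F := F)
  unfold unitMass
  split_ifs <;> positivity

lemma unitMass_le (a : F) : unitMass F a ≤ ((Fintype.card F : ℝ) - 1)⁻¹ := by
  have := card_sub_one_pos (F := F)
  unfold unitMass
  split_ifs
  · positivity
  · exact le_rfl

lemma sum_ite_eq_else_inv_card_sub_one (b : F) (c : ℝ) :
    ∑ a : F, (if a = b then c else ((Fintype.card F : ℝ) - 1)⁻¹) = c + 1 := by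
  rw [← Finset.add_sum_erase _ _ (Finset.mem_univ b), if_pos rfl,
    Finset.sum_congr rfl (fun a ha => if_neg (Finset.ne_of_mem_erase ha)), Finset.sum_const,
    Finset.card_erase_of_mem (Finset.mem_univ b), Finset.card_univ, nsmul_eq_mul,
    Nat.cast_sub Fintype.card_pos, Nat.cast_one, mul_inv_cancel₀ card_sub_one_pos.ne']

lemma sum_unitMass : ∑ a : F, unitMass F a = 1 := by
  simpa [unitMass] using sum_ite_eq_else_inv_card_sub_one (0 : F) 0

lemma sum_prod_unitMass (k : ℕ) : ∑ u : Fin k → F, ∏ i, unitMass F (u i) = 1 := by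
  rw [← Fintype.prod_sum (fun (_ : Fin k) (a : F) => unitMass F a)]
  simp [sum_unitMass]

/-- A nontrivial linear combination of independent uniform elements of `F^×` takes a given value
with probability at most `1 / (|F| - 1)`. -/
lemma sum_prod_unitMass_of_linear_eq_le {k : ℕ} {v : Fin k → F} {j : Fin k} (hj : v j ≠ 0)
    (c : F) :
    ∑ u : Fin k → F, (if ∑ i, u i * v i = c then ∏ i, unitMass F (u i) else 0) ≤
      ((Fintype.card F : ℝ) - 1)⁻¹ := by
  obtain _ | k := k
  · exact j.elim0
  rw [← (Fin.insertNthEquiv (fun _ => F) j).sum_comp, Fintype.sum_prod_type, Finset.sum_comm]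
  calc _ ≤ ∑ r : Fin k → F, ((Fintype.card F : ℝ) - 1)⁻¹ * ∏ i, unitMass F (r i) := by
        refine Finset.sum_le_sum fun r _ => ?_
        have hr : 0 ≤ ∏ i, unitMass F (r i) := Finset.prod_nonneg fun i _ => unitMass_nonneg _
        simp only [Fin.insertNthEquiv_apply, Fin.sum_univ_succAbove _ j,
          Fin.prod_univ_succAbove _ j, Fin.insertNth_apply_same, Fin.insertNth_apply_succAbove]
        have hiff : ∀ a : F, a * v j + ∑ i, r i * v (j.succAbove i) = c ↔
            a = (c - ∑ i, r i * v (j.succAbove i)) / v j := fun a => by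
          rw [eq_div_iff hj, eq_sub_iff_add_eq]
        simp only [hiff, Finset.sum_ite_eq', Finset.mem_univ, if_true]
        exact mul_le_mul_of_nonneg_right (unitMass_le _) hr
    _ = _ := by rw [← Finset.mul_sum, sum_prod_unitMass, mul_one]

lemma sum_prod_unitMass_of_eq_le {k : ℕ} (v v' : Fin k → F) {b b' : F}
    (hv : v = v' → b = b') :
    ∑ u : Fin k → F, (if ∑ i, u i * v' i = ∑ i, u i * v i then ∏ i, unitMass F (u i) else 0) ≤
      if b = b' then 1 else ((Fintype.card F : ℝ) - 1)⁻¹ := by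
  split_ifs with hb
  · rw [← sum_prod_unitMass (F := F) k]
    refine Finset.sum_le_sum fun u _ => ?_
    split_ifs
    · exact le_rfl
    · exact Finset.prod_nonneg fun i _ => unitMass_nonneg _
  · obtain ⟨j, hj⟩ := Function.ne_iff.1 (mt hv hb)
    have := sum_prod_unitMass_of_linear_eq_le (v := fun i => v' i - v i) (j := j)
      (sub_ne_zero.2 (Ne.symm hj)) 0
    simpa only [mul_sub, Finset.sum_sub_distrib, sub_eq_zero] using this

/-- The expected size of the fibre of `y ↦ (∑ i, g i τ * ψ i y τ)_τ` through `y'`, for `g` uniform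
on tuples of units, is at most `2 ^ n`. -/
lemma sum_fibre_prod_unitMass_le {n k : ℕ} (ψ : Fin k → (Fin n → F) → (Fin n → F))
    (h : (Fin k → F) → F)
    (hh : ∀ (y : Fin n → F) (τ : Fin n), h (fun i => ψ i y τ) = y τ) (y' : Fin n → F) :
    ∑ y : Fin n → F, ∑ g : Fin k → Fin n → F,
      (if (fun τ => ∑ i, g i τ * ψ i y' τ) = (fun τ => ∑ i, g i τ * ψ i y τ) then
        ∏ i, ∏ τ, unitMass F (g i τ) else 0) ≤ 2 ^ n := by
  calc _ ≤ ∑ y : Fin n → F, ∏ τ, (if y τ = y' τ then 1 else ((Fintype.card F : ℝ) - 1)⁻¹) := by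
        refine Finset.sum_le_sum fun y _ => ?_
        rw [← (Equiv.piComm (fun (_ : Fin n) (_ : Fin k) => F)).sum_comp]
        calc _ = ∑ u : Fin n → Fin k → F, ∏ τ,
              (if ∑ i, u τ i * ψ i y' τ = ∑ i, u τ i * ψ i y τ then
                ∏ i, unitMass F (u τ i) else 0) := by
              refine Finset.sum_congr rfl fun u _ => ?_
              rw [Finset.prod_ite_zero, Finset.prod_comm]
              simp [funext_iff]
          _ = ∏ τ, ∑ u : Fin k → F,
              (if ∑ i, u i * ψ i y' τ = ∑ i, u i * ψ i y τ then
                ∏ i, unitMass F (u i) else 0) :=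
              (Fintype.prod_sum (fun (τ : Fin n) (u : Fin k → F) =>
                if ∑ i, u i * ψ i y' τ = ∑ i, u i * ψ i y τ then
                  ∏ i, unitMass F (u i) else 0)).symm
          _ ≤ _ := by
              refine Finset.prod_le_prod (fun τ _ => Finset.sum_nonneg fun u _ => ?_) fun τ _ =>
                sum_prod_unitMass_of_eq_le (fun i => ψ i y τ) (fun i => ψ i y' τ) fun hv => ?_
              · split_ifs
                · exact Finset.prod_nonneg fun i _ => unitMass_nonneg _
                · exact le_rfl
              · rw [← hh y τ, ← hh y' τ, hv]
    _ = ∏ τ, ∑ a : F, (if a = y' τ then 1 else ((Fintype.card F : ℝ) - 1)⁻¹) :=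
        (Fintype.prod_sum (fun (τ : Fin n) (a : F) =>
          if a = y' τ then 1 else ((Fintype.card F : ℝ) - 1)⁻¹)).symm
    _ = 2 ^ n := by simp [sum_ite_eq_else_inv_card_sub_one, one_add_one_eq_two]

end UnitMass

/-- **Finite-field aligned-images entropy bound** (core of the classical DoF converse,
Appendix C.1): with `ψ_1, …, ψ_k : F^n → F^n` admitting a coordinatewise inverse `h`,
`Y` arbitrary, and `G = (G_{i,τ})` a family of mutually independent uniform-on-`F^×`
coefficients independent of `Y`, setting `Z_τ = ∑_i G_{i,τ}·ψ_i(Y)_τ` one has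
`H[Y | (Z, G)] ≤ n·log 2`. -/
theorem aligned_images_entropy_bound
    {Ω : Type*} [Fintype Ω] [MeasurableSpace Ω] [MeasurableSingletonClass Ω]
    (μ : Measure Ω) [IsProbabilityMeasure μ]
    {F : Type*} [Field F] [Fintype F] [DecidableEq F]
    (n k : ℕ) (hn : 1 ≤ n) (hk : 1 ≤ k)
    (ψ : Fin k → (Fin n → F) → (Fin n → F))
    (h : (Fin k → F) → F)
    (hh : ∀ (y : Fin n → F) (τ : Fin n), h (fun i => ψ i y τ) = y τ)
    (Y : Ω → Fin n → F) (G : Ω → Fin k → Fin n → F)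
    (hjoint : ∀ (g : Fin k → Fin n → F) (y : Fin n → F),
      μ ((fun ω => (G ω, Y ω)) ⁻¹' {(g, y)}) =
        (∏ i : Fin k, ∏ τ : Fin n,
          if g i τ = 0 then 0 else ((Fintype.card F : ENNReal) - 1)⁻¹) * μ (Y ⁻¹' {y})) :
    condShannonEntropy μ Y
        (fun ω => ((fun τ => ∑ i : Fin k, G ω i τ * ψ i (Y ω) τ), G ω)) ≤
      n * Real.log 2 := by
  set z : (Fin k → Fin n → F) → (Fin n → F) → Fin n → F :=
    fun g y τ => ∑ i, g i τ * ψ i y τ with hz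
  set W : Ω → (Fin n → F) × (Fin k → Fin n → F) := fun ω => (z (G ω) (Y ω), G ω) with hW
  set w : (Fin k → Fin n → F) → ℝ := fun g => ∏ i, ∏ τ, unitMass F (g i τ) with hw
  have hjoint_real : ∀ g y, μ.real (G ⁻¹' {g} ∩ Y ⁻¹' {y}) = w g * μ.real (Y ⁻¹' {y}) := by
    intro g y
    have hset : G ⁻¹' {g} ∩ Y ⁻¹' {y} = (fun ω => (G ω, Y ω)) ⁻¹' {(g, y)} := by
      ext ω; simp
    have hcard : (1 : ENNReal) ≤ Fintype.card F := by exact_mod_cast Fintype.card_pos (α := F)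
    rw [measureReal_def, hset, hjoint, ENNReal.toReal_mul, ← measureReal_def]
    congr 1
    simp [hw, unitMass, ENNReal.toReal_prod, apply_ite ENNReal.toReal, ENNReal.toReal_inv,
      ENNReal.toReal_sub_of_le hcard]
  have hcell : ∀ b y, W ⁻¹' {b} ∩ Y ⁻¹' {y} =
      if z b.2 y = b.1 then G ⁻¹' {b.2} ∩ Y ⁻¹' {y} else ∅ := by
    rintro ⟨c, g⟩ y
    ext ω
    split_ifs with hc <;> simp only [hW, Set.mem_inter_iff, Set.mem_preimage,
      Set.mem_singleton_iff, Prod.mk.injEq, Set.mem_empty_iff_false] <;> grind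
  have hmass : ∀ b, μ.real (W ⁻¹' {b}) =
      ∑ y', if z b.2 y' = b.1 then w b.2 * μ.real (Y ⁻¹' {y'}) else 0 := by
    intro b
    rw [← sum_real_inter_preimage_singleton μ Y]
    refine Finset.sum_congr rfl fun y' _ => ?_
    rw [hcell]
    split_ifs
    · exact hjoint_real _ _
    · simp
  have hmarginal : ∑ y', μ.real (Y ⁻¹' {y'}) = 1 := by
    simpa using sum_real_inter_preimage_singleton μ Y Set.univ
  rw [← Real.log_pow]
  refine condShannonEntropy_le_log μ Y W (by positivity) ?_
  calc _ ≤ ∑ b, ∑ y, (if z b.2 y = b.1 then μ.real (W ⁻¹' {b}) else 0) := by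
        gcongr with b _ y _
        by_cases hc : z b.2 y = b.1
        · rw [if_pos hc]
          split_ifs
          · exact measureReal_nonneg
          · exact le_rfl
        · simp [hcell, hc]
    _ = ∑ g, ∑ y, μ.real (W ⁻¹' {(z g y, g)}) := by
        rw [Fintype.sum_prod_type_right]
        refine Finset.sum_congr rfl fun g _ => ?_
        rw [Finset.sum_comm]
        simp
    _ = ∑ y', μ.real (Y ⁻¹' {y'}) * ∑ y, ∑ g, (if z g y' = z g y then w g else 0) := by
        simp_rw [hmass, Finset.mul_sum]
        refine (Finset.sum_comm.trans (Finset.sum_congr rfl fun y _ => Finset.sum_comm)).trans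
          (Finset.sum_comm.trans ?_)
        simp_rw [mul_ite, mul_zero, mul_comm (w _)]
    _ ≤ ∑ y', μ.real (Y ⁻¹' {y'}) * 2 ^ n := by
        gcongr with y' _
        exact sum_fibre_prod_unitMass_le ψ h hh y'
    _ = 2 ^ n := by rw [← Finset.sum_mul, hmarginal, one_mul]
end

section
/- Expected aligned-image-set size bound (Appendix C.1): Let F be a finite field, and let n ≥ 1, k ≥ 1. Let ψ_1,…,ψ_k : F^n → F^n be arbitrary functions and suppose there exists h : F^k → F such that h(ψ_1(y)_τ, …, ψ_k(y)_τ) = y_τ for every y ∈ F^n and every coordinate τ ∈ [n]. Let G = (G_{i,τ})_{i∈[k], τ∈[n]} be a family of mutually independent random variables, each uniform on F^×. Then for every fixed ȳ ∈ F^n, Σ_{y∈F^n} Pr[ ∀τ∈[n] : Σ_{i=1}^k G_{i,τ}·(ψ_i(y)_τ − ψ_i(ȳ)_τ) = 0 ] ≤ 2^n; equivalently, the expected cardinality of the aligned image set S(ȳ, G) = { y ∈ F^n : ∀τ, Σ_{i=1}^k G_{i,τ}·ψ_i(y)_τ = Σ_{i=1}^k G_{i,τ}·ψ_i(ȳ)_τ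 } is at most 2^n. -/
open MeasureTheory

/-- The probability mass function of the uniform distribution on the nonzero elements of `F`,
extended by zero to `F`. -/
noncomputable def unitWeight {F : Type*} [Field F] [Fintype F] [DecidableEq F] (x : F) : ENNReal :=
  if x = 0 then 0 else ((Fintype.card F : ENNReal) - 1)⁻¹

section UnitWeight

variable {F : Type*} [Field F] [Fintype F] [DecidableEq F]

theorem unitWeight_le (x : F) : unitWeight x ≤ ((Fintype.card F : ENNReal) - 1)⁻¹ := by
  unfold unitWeight
  split_ifs <;> simp

theorem sum_ite_eq_zero_inv_card_sub_one (a : F) :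
    ∑ x : F, (if x = a then 0 else ((Fintype.card F : ENNReal) - 1)⁻¹) = 1 := by
  have hcard : 1 < Fintype.card F := Fintype.one_lt_card
  have hcast : (Fintype.card F : ENNReal) - 1 = ((Fintype.card F - 1 : ℕ) : ENNReal) := by
    simp [ENNReal.natCast_sub]
  rw [hcast, Finset.sum_ite, Finset.sum_const_zero, zero_add, Finset.sum_const, nsmul_eq_mul,
    Finset.filter_ne' Finset.univ a, Finset.card_erase_of_mem (Finset.mem_univ a),
    Finset.card_univ]
  exact ENNReal.mul_inv_cancel (by exact_mod_cast (by omega : Fintype.card F - 1 ≠ 0))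
    (ENNReal.natCast_ne_top _)

theorem sum_unitWeight : ∑ x : F, unitWeight x = 1 :=
  sum_ite_eq_zero_inv_card_sub_one 0

theorem sum_prod_unitWeight (ι : Type*) [Fintype ι] [DecidableEq ι] :
    ∑ v : ι → F, ∏ i, unitWeight (v i) = 1 := by
  have := Finset.prod_univ_sum (fun _ : ι => (Finset.univ : Finset F)) fun _ x => unitWeight x
  rw [Fintype.piFinset_univ] at this
  simp [← this, sum_unitWeight]

/-- A random vector with independent uniform nonzero coordinates lies on a given hyperplane with
probability at most `1 / (|F| - 1)`. -/
theorem sum_prod_unitWeight_hyperplane_le {ι : Type*} [Fintype ι] [DecidableEq ι]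
    {d : ι → F} (hd : d ≠ 0) :
    ∑ v : ι → F, (if ∑ i, v i * d i = 0 then ∏ i, unitWeight (v i) else 0) ≤
      ((Fintype.card F : ENNReal) - 1)⁻¹ := by
  obtain ⟨j, hj⟩ := Function.ne_iff.mp hd
  rw [Pi.zero_apply] at hj
  rw [← (Equiv.funSplitAt j F).symm.sum_comp, Fintype.sum_prod_type, Finset.sum_comm]
  have hfiber (u : {i // i ≠ j} → F) :
      ∑ x : F, (if ∑ i, (Equiv.funSplitAt j F).symm (x, u) i * d i = 0 then
          ∏ i, unitWeight ((Equiv.funSplitAt j F).symm (x, u) i) else 0) ≤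
        ((Fintype.card F : ENNReal) - 1)⁻¹ * ∏ i, unitWeight (u i) := by
    have hoff (i : {i // i ≠ j}) (x : F) : (Equiv.funSplitAt j F).symm (x, u) i = u i := by
      simp [Equiv.funSplitAt, Equiv.piSplitAt, i.2]
    have hon (x : F) : (Equiv.funSplitAt j F).symm (x, u) j = x := by
      simp [Equiv.funSplitAt, Equiv.piSplitAt]
    have hroot (x : F) : x * d j + ∑ i : {i // i ≠ j}, u i * d i = 0 ↔
        x = -(∑ i : {i // i ≠ j}, u i * d i) / d j := by
      rw [eq_div_iff hj, eq_neg_iff_add_eq_zero]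
    simp only [Fintype.sum_eq_add_sum_subtype_ne _ j, Fintype.prod_eq_mul_prod_subtype_ne _ j,
      hoff, hon, hroot, Finset.sum_ite_eq', Finset.mem_univ, if_true]
    gcongr
    exact unitWeight_le _
  calc
    _ ≤ ∑ u : {i // i ≠ j} → F,
        ((Fintype.card F : ENNReal) - 1)⁻¹ * ∏ i, unitWeight (u i) :=
      Finset.sum_le_sum fun u _ => hfiber u
    _ = _ := by rw [← Finset.mul_sum, sum_prod_unitWeight, mul_one]

end UnitWeight

theorem measure_setOf_eq_sum_fiber {Ω α : Type*} [Finite Ω] [MeasurableSpace Ω]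
    [MeasurableSingletonClass Ω] [Fintype α] (μ : Measure Ω) (X : Ω → α) (p : α → Prop)
    [DecidablePred p] :
    μ {ω | p (X ω)} = ∑ a, if p a then μ (X ⁻¹' {a}) else 0 := by
  rw [← Finset.sum_filter,
    sum_measure_preimage_singleton _ fun a _ => (Set.toFinite (X ⁻¹' {a})).measurableSet]
  congr 1
  ext ω
  simp

theorem sum_ite_forall_prod {ι κ α R : Type*} [Fintype ι] [DecidableEq ι] [Fintype κ]
    [DecidableEq κ] [Fintype α] [CommSemiring R] (w : α → R) (p : κ → (ι → α) → Prop)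
    [∀ τ, DecidablePred (p τ)]
    [DecidablePred fun g : ι → κ → α => ∀ τ, p τ (fun i => g i τ)] :
    ∑ g : ι → κ → α, (if ∀ τ, p τ (fun i => g i τ) then ∏ i, ∏ τ, w (g i τ) else 0) =
      ∏ τ, ∑ v : ι → α, if p τ v then ∏ i, w (v i) else 0 := by
  rw [Finset.prod_univ_sum, Fintype.piFinset_univ,
    ← (Equiv.piComm fun (_ : κ) (_ : ι) => α).sum_comp]
  refine Finset.sum_congr rfl fun g _ => ?_
  split_ifs with hp
  · rw [Finset.prod_comm]
    exact Finset.prod_congr rfl fun τ _ => (if_pos (hp τ)).symm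
  · obtain ⟨τ, hτ⟩ := not_forall.mp hp
    exact (Finset.prod_eq_zero (Finset.mem_univ τ) (if_neg hτ)).symm

/-- **Expected aligned-image-set size bound** (Appendix C.1): with `ψ_1, …, ψ_k : F^n → F^n`
admitting a coordinatewise inverse `h`, and `G = (G_{i,τ})` a family of mutually independent
uniform-on-`F^×` coefficients, for every fixed `ȳ ∈ F^n` the expected cardinality of the
aligned image set `S(ȳ, G)` is at most `2^n`:
`∑_{y ∈ F^n} Pr[∀ τ, ∑_i G_{i,τ}·(ψ_i(y)_τ − ψ_i(ȳ)_τ) = 0] ≤ 2^n`. -/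
theorem aligned_image_set_expected_size
    {Ω : Type*} [Fintype Ω] [MeasurableSpace Ω] [MeasurableSingletonClass Ω]
    (μ : Measure Ω) [IsProbabilityMeasure μ]
    {F : Type*} [Field F] [Fintype F] [DecidableEq F]
    (n k : ℕ) (hn : 1 ≤ n) (hk : 1 ≤ k)
    (ψ : Fin k → (Fin n → F) → (Fin n → F))
    (h : (Fin k → F) → F)
    (hh : ∀ (y : Fin n → F) (τ : Fin n), h (fun i => ψ i y τ) = y τ)
    (G : Ω → Fin k → Fin n → F)
    (hG : ∀ g : Fin k → Fin n → F,
      μ (G ⁻¹' {g}) = ∏ i : Fin k, ∏ τ : Fin n,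
        if g i τ = 0 then 0 else ((Fintype.card F : ENNReal) - 1)⁻¹)
    (ybar : Fin n → F) :
    ∑ y : Fin n → F,
        μ {ω | ∀ τ : Fin n, ∑ i : Fin k, G ω i τ * (ψ i y τ - ψ i ybar τ) = 0} ≤
      2 ^ n := by
  have hbound (y : Fin n → F) :
      μ {ω | ∀ τ : Fin n, ∑ i : Fin k, G ω i τ * (ψ i y τ - ψ i ybar τ) = 0} ≤
        ∏ τ, if y τ = ybar τ then 1 else ((Fintype.card F : ENNReal) - 1)⁻¹ := by
    rw [measure_setOf_eq_sum_fiber μ G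
      fun g => ∀ τ, ∑ i : Fin k, g i τ * (ψ i y τ - ψ i ybar τ) = 0]
    simp only [hG]
    refine (sum_ite_forall_prod unitWeight
      fun τ v => ∑ i : Fin k, v i * (ψ i y τ - ψ i ybar τ) = 0).trans_le ?_
    refine Finset.prod_le_prod' fun τ _ => ?_
    split_ifs with hy
    · rw [← sum_prod_unitWeight (F := F) (Fin k)]
      refine Finset.sum_le_sum fun v _ => ?_
      split_ifs <;> simp
    · refine sum_prod_unitWeight_hyperplane_le (d := fun i => ψ i y τ - ψ i ybar τ) fun hd => hy ?_
      rw [← hh y τ, ← hh ybar τ]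
      congr 1
      funext i
      exact sub_eq_zero.mp (congrFun hd i)
  have hcoord (τ : Fin n) :
      ∑ x : F, (if x = ybar τ then 1 else ((Fintype.card F : ENNReal) - 1)⁻¹) = 2 := by
    have hsplit (x : F) : (if x = ybar τ then 1 else ((Fintype.card F : ENNReal) - 1)⁻¹) =
        (if x = ybar τ then 1 else 0) +
          (if x = ybar τ then 0 else ((Fintype.card F : ENNReal) - 1)⁻¹) := by
      split_ifs <;> simp
    simp only [hsplit, Finset.sum_add_distrib, sum_ite_eq_zero_inv_card_sub_one, Finset.sum_ite_eq',
      Finset.mem_univ, if_true, one_add_one_eq_two]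
  calc
    _ ≤ ∑ y : Fin n → F,
        ∏ τ, (if y τ = ybar τ then 1 else ((Fintype.card F : ENNReal) - 1)⁻¹) :=
      Finset.sum_le_sum fun y _ => hbound y
    _ = ∏ τ : Fin n,
        ∑ x : F, (if x = ybar τ then 1 else ((Fintype.card F : ENNReal) - 1)⁻¹) := by
      rw [Finset.prod_univ_sum, Fintype.piFinset_univ]
    _ = 2 ^ n := by simp only [hcoord, Finset.prod_const, Finset.card_univ, Fintype.card_fin]
end

section
/- Fading dirty paper classical converse core (Theorem 10): Let F be a finite field, n ≥ 1, and let ψ : F^n → F^n be an arbitrary function. Let Θ : Ω → F^n be any random variable and let G = (G_τ)_{τ∈[n]} be mutually independent random variables, each uniform on F^×, with the family G independent of Θ. Then H[Θ | (ψ(Θ) + G⊙Θ, G)] ≤ n·log 2, where (G⊙Θ)_τ = G_τ·Θ_τ and the sum ψ(Θ) + G⊙Θ is coordinatewise in F. -/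
open MeasureTheory ProbabilityTheory

/-- The tangent-line bound for `x ↦ -x log x` at `x = K⁻¹`. -/
theorem negMulLog_le_inv_sub_add {p K : ℝ} (hp : 0 ≤ p) (hK : 0 < K) :
    Real.negMulLog p ≤ K⁻¹ - p + p * Real.log K := by
  rcases hp.eq_or_lt with rfl | hp
  · simpa using hK.le
  · have h := mul_le_mul_of_nonneg_left
      (Real.log_le_sub_one_of_pos (inv_pos.2 (mul_pos hp hK))) hp.le
    rw [Real.log_inv, Real.log_mul hp.ne' hK.ne'] at h
    have h' : p * ((p * K)⁻¹ - 1) = K⁻¹ - p := by field_simp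
    rw [Real.negMulLog]
    linarith

theorem sum_toReal_measure_preimage_singleton_mul
    {Ω : Type*} [MeasurableSpace Ω] [DiscreteMeasurableSpace Ω] (μ : Measure Ω)
    [IsFiniteMeasure μ] {B C : Type*} [Fintype B] [Fintype C]
    (W : Ω → C) (f : C → B) (h : B → ℝ) :
    ∑ b, (μ ((fun ω => f (W ω)) ⁻¹' {b})).toReal * h b =
      ∑ c, (μ (W ⁻¹' {c})).toReal * h (f c) := by
  classical
  rw [← Finset.sum_fiberwise (s := Finset.univ) (g := f)]
  refine Finset.sum_congr rfl fun b _ => ?_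
  have hb : (fun ω => f (W ω)) ⁻¹' {b} =
      W ⁻¹' ((Finset.univ.filter fun c => f c = b : Finset C) : Set C) := by
    ext ω; simp
  have hs := sum_measureReal_preimage_singleton (μ := μ) (f := W)
    (Finset.univ.filter fun c => f c = b) fun _ _ => MeasurableSet.of_discrete
  rw [hb, ← measureReal_def, ← hs, Finset.sum_mul]
  refine Finset.sum_congr rfl fun c hc => ?_
  rw [(Finset.mem_filter.1 hc).2, measureReal_def]

theorem sum_toReal_measure_preimage_singleton
    {Ω : Type*} [MeasurableSpace Ω] [DiscreteMeasurableSpace Ω] (μ : Measure Ω)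
    [IsProbabilityMeasure μ] {A : Type*} [Fintype A] (X : Ω → A) :
    ∑ a, (μ (X ⁻¹' {a})).toReal = 1 := by
  have h := sum_measureReal_preimage_singleton (μ := μ) (f := X) Finset.univ
    fun _ _ => MeasurableSet.of_discrete
  simpa [measureReal_def] using h

theorem shannonEntropy_le_card_div_sub_one_add_log
    {Ω : Type*} [MeasurableSpace Ω] [DiscreteMeasurableSpace Ω] (μ : Measure Ω)
    [IsProbabilityMeasure μ] {A : Type*} [Fintype A] (X : Ω → A) (S : Finset A)
    (hS : ∀ a ∉ S, μ (X ⁻¹' {a}) = 0) {K : ℝ} (hK : 0 < K) :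
    shannonEntropy μ X ≤ S.card / K - 1 + Real.log K := by
  have h1 : ∑ a ∈ S, (μ (X ⁻¹' {a})).toReal = 1 := by
    rw [← sum_toReal_measure_preimage_singleton μ X]
    exact Finset.sum_subset (Finset.subset_univ S) fun a _ ha => by simp [hS a ha]
  calc shannonEntropy μ X
      = ∑ a ∈ S, Real.negMulLog (μ (X ⁻¹' {a})).toReal :=
        (Finset.sum_subset (Finset.subset_univ S) fun a _ ha => by simp [hS a ha]).symm
    _ ≤ ∑ a ∈ S, (K⁻¹ - (μ (X ⁻¹' {a})).toReal + (μ (X ⁻¹' {a})).toReal * Real.log K) :=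
        Finset.sum_le_sum fun a _ => negMulLog_le_inv_sub_add ENNReal.toReal_nonneg hK
    _ = S.card / K - 1 + Real.log K := by
        rw [Finset.sum_add_distrib, Finset.sum_sub_distrib, ← Finset.sum_mul, h1]
        simp [div_eq_mul_inv]

/-- If `Y` confines `X` to a list of expected size at most `K`, then `H[X | Y] ≤ log K`. -/
theorem condShannonEntropy_le_log_s8
    {Ω : Type*} [MeasurableSpace Ω] [DiscreteMeasurableSpace Ω] (μ : Measure Ω)
    [IsProbabilityMeasure μ] {A B : Type*} [Fintype A] [Fintype B] (X : Ω → A) (Y : Ω → B)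
    (S : B → Finset A) (hS : ∀ ω, X ω ∈ S (Y ω)) {K : ℝ} (hK : 0 < K)
    (hcard : ∑ b, (μ (Y ⁻¹' {b})).toReal * (S b).card ≤ K) :
    condShannonEntropy μ X Y ≤ Real.log K := by
  have hb (b : B) : (μ (Y ⁻¹' {b})).toReal * shannonEntropy (μ[|Y ⁻¹' {b}]) X ≤
      (μ (Y ⁻¹' {b})).toReal * ((S b).card / K - 1 + Real.log K) := by
    by_cases h0 : μ (Y ⁻¹' {b}) = 0
    · simp [h0]
    · have := cond_isProbabilityMeasure h0
      refine mul_le_mul_of_nonneg_left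
        (shannonEntropy_le_card_div_sub_one_add_log _ X (S b) (fun a ha => ?_) hK)
        ENNReal.toReal_nonneg
      have hdisj : Y ⁻¹' {b} ∩ X ⁻¹' {a} = ∅ := by
        refine Set.eq_empty_of_forall_notMem fun ω hω => ha ?_
        obtain ⟨rfl, rfl⟩ := hω
        exact hS ω
      rw [cond_apply MeasurableSet.of_discrete, hdisj, measure_empty, mul_zero]
  calc condShannonEntropy μ X Y
      ≤ ∑ b, (μ (Y ⁻¹' {b})).toReal * ((S b).card / K - 1 + Real.log K) :=
        Finset.sum_le_sum fun b _ => hb b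
    _ = (∑ b, (μ (Y ⁻¹' {b})).toReal * (S b).card) / K +
          (∑ b, (μ (Y ⁻¹' {b})).toReal) * (Real.log K - 1) := by
        rw [Finset.sum_div, Finset.sum_mul, ← Finset.sum_add_distrib]
        exact Finset.sum_congr rfl fun b _ => by ring
    _ ≤ Real.log K := by
        have := (div_le_one hK).2 hcard
        rw [sum_toReal_measure_preimage_singleton]
        linarith

/-- The probability mass function of the uniform distribution on the nonzero elements of `F`. -/
noncomputable def uniformNonzero (F : Type*) [Field F] [Fintype F] [DecidableEq F] (a : F) : ℝ :=
  if a = 0 then 0 else ((Fintype.card F : ℝ) - 1)⁻¹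

section UniformNonzero

variable {F : Type*} [Field F] [Fintype F] [DecidableEq F]

theorem card_sub_one_pos_of_field (F : Type*) [Field F] [Fintype F] :
    0 < (Fintype.card F : ℝ) - 1 :=
  sub_pos.2 (Nat.one_lt_cast.2 Fintype.one_lt_card)

theorem uniformNonzero_nonneg (a : F) : 0 ≤ uniformNonzero F a := by
  have := card_sub_one_pos_of_field F
  unfold uniformNonzero
  split_ifs <;> positivity

theorem uniformNonzero_le (a : F) : uniformNonzero F a ≤ ((Fintype.card F : ℝ) - 1)⁻¹ := by
  have := card_sub_one_pos_of_field F
  unfold uniformNonzero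
  split_ifs
  · positivity
  · exact le_rfl

/-- A function taking the value `1` at `c` and `(|F| - 1)⁻¹` elsewhere has total mass `2`. -/
theorem sum_ite_eq_one_inv_card_sub_one (c : F) :
    ∑ a : F, (if a = c then (1 : ℝ) else ((Fintype.card F : ℝ) - 1)⁻¹) = 2 := by
  have h := (card_sub_one_pos_of_field F).ne'
  rw [← Finset.add_sum_erase _ _ (Finset.mem_univ c),
    Finset.sum_congr rfl fun a ha => if_neg (Finset.ne_of_mem_erase ha), Finset.sum_const,
    Finset.card_erase_of_mem (Finset.mem_univ c), Finset.card_univ, nsmul_eq_mul,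
    Nat.cast_sub Fintype.card_pos, Nat.cast_one, mul_inv_cancel₀ h]
  norm_num

theorem sum_uniformNonzero : ∑ a : F, uniformNonzero F a = 1 := by
  have h := sum_ite_eq_one_inv_card_sub_one (0 : F)
  have h' : ∀ a : F, (if a = 0 then (1 : ℝ) else ((Fintype.card F : ℝ) - 1)⁻¹) =
      uniformNonzero F a + if a = 0 then 1 else 0 := fun a => by
    unfold uniformNonzero
    split_ifs <;> simp
  simp only [h', Finset.sum_add_distrib, Finset.sum_ite_eq', Finset.mem_univ, if_true] at h
  linarith

/-- Two lines of distinct slopes collide at a uniform nonzero point with probability at most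
`(|F| - 1)⁻¹`. -/
theorem sum_uniformNonzero_mul_collision_le (x y u v : F) :
    ∑ a : F, uniformNonzero F a * (if y + a * v = x + a * u then 1 else 0) ≤
      if v = u then (1 : ℝ) else ((Fintype.card F : ℝ) - 1)⁻¹ := by
  split_ifs with h
  · refine (Finset.sum_le_sum fun a _ => ?_).trans_eq (sum_uniformNonzero (F := F))
    exact mul_le_of_le_one_right (uniformNonzero_nonneg a) (by split_ifs <;> norm_num)
  · have hvu : v - u ≠ 0 := sub_ne_zero.2 h
    have hiff : ∀ a : F, y + a * v = x + a * u ↔ a = (x - y) / (v - u) := fun a => by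
      rw [eq_div_iff hvu]
      constructor <;> intro e <;> linear_combination e
    simpa [hiff] using uniformNonzero_le ((x - y) / (v - u))

theorem sum_prod_uniformNonzero_mul_card_le {n : ℕ} (ψ : (Fin n → F) → (Fin n → F))
    (θ : Fin n → F) :
    ∑ g : Fin n → F, (∏ τ, uniformNonzero F (g τ)) *
      ((Finset.univ.filter fun θ' : Fin n → F =>
        ∀ τ, ψ θ' τ + g τ * θ' τ = ψ θ τ + g τ * θ τ).card : ℝ) ≤ 2 ^ n := by
  calc _ = ∑ θ' : Fin n → F, ∑ g : Fin n → F, ∏ τ, (uniformNonzero F (g τ) *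
          (if ψ θ' τ + g τ * θ' τ = ψ θ τ + g τ * θ τ then 1 else 0)) := by
        rw [Finset.sum_comm]
        refine Finset.sum_congr rfl fun g _ => ?_
        simp only [Finset.prod_mul_distrib, ← Finset.mul_sum, Finset.prod_boole,
          Finset.mem_univ, true_imp_iff, Finset.sum_boole]
    _ = ∑ θ' : Fin n → F, ∏ τ, ∑ a : F, (uniformNonzero F a *
          (if ψ θ' τ + a * θ' τ = ψ θ τ + a * θ τ then 1 else 0)) := by
        refine Finset.sum_congr rfl fun θ' _ => ?_
        rw [Finset.prod_univ_sum, Fintype.piFinset_univ]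
    _ ≤ ∑ θ' : Fin n → F, ∏ τ,
          (if θ' τ = θ τ then (1 : ℝ) else ((Fintype.card F : ℝ) - 1)⁻¹) := by
        refine Finset.sum_le_sum fun θ' _ => Finset.prod_le_prod (fun τ _ => ?_) fun τ _ =>
          sum_uniformNonzero_mul_collision_le _ _ _ _
        refine Finset.sum_nonneg fun a _ => mul_nonneg (uniformNonzero_nonneg a) ?_
        split_ifs <;> norm_num
    _ = ∏ τ : Fin n, ∑ a : F,
          (if a = θ τ then (1 : ℝ) else ((Fintype.card F : ℝ) - 1)⁻¹) := by
        rw [Finset.prod_univ_sum, Fintype.piFinset_univ]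
    _ = 2 ^ n := by simp [sum_ite_eq_one_inv_card_sub_one]

theorem toReal_ite_inv_card_sub_one (a : F) :
    (if a = 0 then (0 : ENNReal) else ((Fintype.card F : ENNReal) - 1)⁻¹).toReal =
      uniformNonzero F a := by
  unfold uniformNonzero
  split_ifs
  · simp
  · rw [ENNReal.toReal_inv, ENNReal.toReal_sub_of_le (by exact_mod_cast Fintype.card_pos)
      (ENNReal.natCast_ne_top _)]
    simp

end UniformNonzero

/-- **Fading dirty paper classical converse core** (Theorem 10): for a finite field `F`,
an arbitrary function `ψ : F^n → F^n`, an arbitrary random variable `Θ : Ω → F^n`, and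
`G = (G_τ)` mutually independent uniform-on-`F^×` coefficients independent of `Θ`,
`H[Θ | (ψ(Θ) + G⊙Θ, G)] ≤ n·log 2`. -/
theorem fading_dirty_paper_converse_core
    {Ω : Type*} [Fintype Ω] [MeasurableSpace Ω] [MeasurableSingletonClass Ω]
    (μ : Measure Ω) [IsProbabilityMeasure μ]
    {F : Type*} [Field F] [Fintype F] [DecidableEq F]
    (n : ℕ) (hn : 1 ≤ n)
    (ψ : (Fin n → F) → (Fin n → F))
    (Θ : Ω → Fin n → F) (G : Ω → Fin n → F)
    (hjoint : ∀ (g θ : Fin n → F),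
      μ ((fun ω => (G ω, Θ ω)) ⁻¹' {(g, θ)}) =
        (∏ τ : Fin n, if g τ = 0 then 0 else ((Fintype.card F : ENNReal) - 1)⁻¹) *
          μ (Θ ⁻¹' {θ})) :
    condShannonEntropy μ Θ
        (fun ω => ((fun τ => ψ (Θ ω) τ + G ω τ * Θ ω τ), G ω)) ≤ n * Real.log 2 := by
  classical
  let S : (Fin n → F) × (Fin n → F) → Finset (Fin n → F) := fun b =>
    Finset.univ.filter fun θ' => ∀ τ, ψ θ' τ + b.2 τ * θ' τ = b.1 τ
  rw [← Real.log_pow]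
  refine condShannonEntropy_le_log_s8 μ Θ _ S (fun ω => by simp [S]) (by positivity) ?_
  rw [sum_toReal_measure_preimage_singleton_mul μ (fun ω => (G ω, Θ ω))
    (fun c => ((fun τ => ψ c.2 τ + c.1 τ * c.2 τ), c.1)) fun b => ((S b).card : ℝ),
    Fintype.sum_prod_type_right]
  calc _ = ∑ θ, (μ (Θ ⁻¹' {θ})).toReal * ∑ g : Fin n → F, (∏ τ, uniformNonzero F (g τ)) *
          ((Finset.univ.filter fun θ' : Fin n → F =>
            ∀ τ, ψ θ' τ + g τ * θ' τ = ψ θ τ + g τ * θ τ).card : ℝ) := by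
        refine Finset.sum_congr rfl fun θ _ => ?_
        rw [Finset.mul_sum]
        refine Finset.sum_congr rfl fun g _ => ?_
        rw [hjoint, ENNReal.toReal_mul, ENNReal.toReal_prod]
        simp only [toReal_ite_inv_card_sub_one, S]
        ring
    _ ≤ ∑ θ, (μ (Θ ⁻¹' {θ})).toReal * 2 ^ n :=
        Finset.sum_le_sum fun θ _ => mul_le_mul_of_nonneg_left
          (sum_prod_uniformNonzero_mul_card_le ψ θ) ENNReal.toReal_nonneg
    _ = 2 ^ n := by
        rw [← Finset.sum_mul, sum_toReal_measure_preimage_singleton, one_mul]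
end

section
/- Tree-path linear program and the leaf count (core of Corollary 1 and of the TDMA achievability of Theorem 6): Let G be a finite tree (a connected acyclic simple graph) on a vertex set V with at least two vertices, and let r ∈ V be a distinguished root. Call a vertex v a leaf if v ≠ r and v has degree 1 in G, and let L be the set of leaves. Then the maximum of Σ_{v ∈ V∖{r}} x(v), taken over all functions x : V → ℝ satisfying x(v) ≥ 0 for all v and, for every leaf ℓ ∈ L, Σ_{v ∈ P(r,ℓ)∖{r}} x(v) ≤ 1 — where P(r,ℓ) denotes the vertex set of the unique path in G from r to ℓ — equals |L|, the number of leaves; moreover the maximum is attained by the indicator function of L. -/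
open Finset

namespace SimpleGraph

variable {V : Type*} {G : SimpleGraph V}

/-- A vertex of degree one on a path is one of its endpoints. -/
theorem Walk.IsPath.eq_start_or_eq_end_of_degree_eq_one {u v w : V} [Fintype (G.neighborSet v)]
    {p : G.Walk u w} (hp : p.IsPath) (hv : v ∈ p.support) (hdeg : G.degree v = 1) :
    v = u ∨ v = w := by
  by_contra! h
  obtain ⟨a, -, ha⟩ := degree_eq_one_iff_existsUnique_adj.mp hdeg
  obtain ⟨q, s, rfl⟩ := Walk.mem_support_iff_exists_append.mp hv
  have hq : ¬ q.Nil := Walk.not_nil_of_ne h.1.symm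
  have hs : ¬ s.Nil := Walk.not_nil_of_ne h.2
  have hqa : q.penultimate = a := ha _ (q.adj_penultimate hq).symm
  have hsa : s.snd = a := ha _ (s.adj_snd hs)
  exact hp.ne_of_mem_support_of_append (s.adj_snd hs).ne'
    (q.getVert_mem_support _) (s.getVert_mem_support _) (hqa.trans hsa.symm)

/-- In a finite acyclic graph, every nontrivial path extends to a path ending in a vertex of
degree one. -/
theorem IsAcyclic.exists_isPath_degree_eq_one [Fintype V] [DecidableRel G.Adj]
    (hG : G.IsAcyclic) {r w : V} (p : G.Walk r w) (hp : p.IsPath) (hw : w ≠ r) :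
    ∃ (l : V) (q : G.Walk r l), q.IsPath ∧ l ≠ r ∧ G.degree l = 1 ∧ p.support ⊆ q.support := by
  induction hn : Fintype.card V - p.length using Nat.strong_induction_on generalizing w with
  | _ n ih =>
    by_cases h : ∃ u, G.Adj w u ∧ u ∉ p.support
    · obtain ⟨u, hadj, hu⟩ := h
      have hur : u ≠ r := fun h => hu (h ▸ p.start_mem_support)
      have hlt := hp.length_lt
      obtain ⟨l, q, hq, hl, hdeg, hsub⟩ := ih (Fintype.card V - (p.concat hadj).length)
        (by rw [Walk.length_concat]; omega) (p.concat hadj) (hp.concat hu hadj) hur rfl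
      exact ⟨l, q, hq, hl, hdeg, List.Subset.trans (p.support_subset_support_concat hadj) hsub⟩
    · push Not at h
      refine ⟨w, p, hp, hw, ?_, List.Subset.refl _⟩
      exact degree_eq_one_iff_existsUnique_adj.mpr
        ⟨p.penultimate, (p.adj_penultimate (Walk.not_nil_of_ne hw.symm)).symm,
          fun u hadj => hG.eq_penultimate_of_adj_end hp hadj (h u hadj)⟩

end SimpleGraph

theorem Finset.sum_biUnion_le_sum_sum_of_nonneg {ι α : Type*} [DecidableEq α] {s : Finset ι}
    {t : ι → Finset α} {f : α → ℝ} (hf : ∀ a, 0 ≤ f a) :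
    ∑ a ∈ s.biUnion t, f a ≤ ∑ i ∈ s, ∑ a ∈ t i, f a := by
  classical
  induction s using Finset.induction_on with
  | empty => simp
  | insert i s hi ih =>
    rw [Finset.biUnion_insert, Finset.sum_insert hi]
    have h := Finset.sum_union_inter (s₁ := t i) (s₂ := s.biUnion t) (f := f)
    have := Finset.sum_nonneg (s := t i ∩ s.biUnion t) fun a _ => hf a
    linarith

/-- **Tree-path linear program and the leaf count** (core of Corollary 1 and of the TDMA
achievability of Theorem 6): for a finite tree `G` on `V` (with `|V| ≥ 2`) rooted at `r`,
the maximum of `∑_{v ≠ r} x(v)` over all `x ≥ 0` satisfying, for every leaf `ℓ`,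
`∑_{v ∈ P(r,ℓ) \ {r}} x(v) ≤ 1` (where `P(r,ℓ)` is the vertex set of the unique `r`–`ℓ`
path), equals the number of leaves; moreover the maximum is attained by the indicator
function of the leaf set. -/
theorem tree_path_LP_leaf_count
    {V : Type} [Fintype V] [DecidableEq V]
    (G : SimpleGraph V) [DecidableRel G.Adj]
    (hT : G.IsTree) (hV : 2 ≤ Fintype.card V) (r : V) :
    IsGreatest
      {s : ℝ | ∃ x : V → ℝ,
        (∀ v, 0 ≤ x v) ∧
        (∀ ℓ : V, ℓ ≠ r ∧ G.degree ℓ = 1 →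
          ∀ p : G.Walk r ℓ, p.IsPath →
            ∑ v ∈ p.support.toFinset.erase r, x v ≤ 1) ∧
        s = ∑ v ∈ Finset.univ.erase r, x v}
      ((Finset.univ.filter (fun v : V => v ≠ r ∧ G.degree v = 1)).card : ℝ) ∧
    ((∀ v : V, (0 : ℝ) ≤ if v ≠ r ∧ G.degree v = 1 then 1 else 0) ∧
      (∀ ℓ : V, ℓ ≠ r ∧ G.degree ℓ = 1 →
        ∀ p : G.Walk r ℓ, p.IsPath →
          ∑ v ∈ p.support.toFinset.erase r,
            (if v ≠ r ∧ G.degree v = 1 then (1 : ℝ) else 0) ≤ 1) ∧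
      ∑ v ∈ Finset.univ.erase r, (if v ≠ r ∧ G.degree v = 1 then (1 : ℝ) else 0) =
        ((Finset.univ.filter (fun v : V => v ≠ r ∧ G.degree v = 1)).card : ℝ)) := by
  have hnonneg : ∀ v : V, (0 : ℝ) ≤ if v ≠ r ∧ G.degree v = 1 then 1 else 0 := by
    intro v
    split_ifs <;> norm_num
  have hpath : ∀ ℓ : V, ℓ ≠ r ∧ G.degree ℓ = 1 → ∀ p : G.Walk r ℓ, p.IsPath →
      ∑ v ∈ p.support.toFinset.erase r,
        (if v ≠ r ∧ G.degree v = 1 then (1 : ℝ) else 0) ≤ 1 := by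
    intro ℓ _ p hp
    rw [Finset.sum_boole]
    norm_cast
    refine (Finset.card_le_card (t := {ℓ}) fun v hv => ?_).trans_eq (Finset.card_singleton ℓ)
    simp only [Finset.mem_filter, Finset.mem_erase, List.mem_toFinset] at hv
    exact Finset.mem_singleton.mpr
      ((hp.eq_start_or_eq_end_of_degree_eq_one hv.1.2 hv.2.2).resolve_left hv.1.1)
  have hsum : ∑ v ∈ Finset.univ.erase r, (if v ≠ r ∧ G.degree v = 1 then (1 : ℝ) else 0) =
      ((Finset.univ.filter (fun v : V => v ≠ r ∧ G.degree v = 1)).card : ℝ) := by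
    rw [Finset.sum_erase _ (by simp), Finset.sum_boole]
  refine ⟨⟨⟨_, hnonneg, hpath, hsum.symm⟩, ?_⟩, hnonneg, hpath, hsum⟩
  rintro _ ⟨x, hx, hle, rfl⟩
  choose P hP using fun ℓ => hT.connected.exists_isPath r ℓ
  set L := Finset.univ.filter (fun v : V => v ≠ r ∧ G.degree v = 1)
  have hcover : Finset.univ.erase r ⊆ L.biUnion fun ℓ => (P ℓ).support.toFinset.erase r := by
    intro v hv
    have hvr := Finset.ne_of_mem_erase hv
    obtain ⟨ℓ, q, hq, hℓ, hdeg, hsub⟩ :=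
      hT.isAcyclic.exists_isPath_degree_eq_one (P v) (hP v) hvr
    obtain rfl : q = P ℓ := (hT.existsUnique_path r ℓ).unique hq (hP ℓ)
    simp only [Finset.mem_biUnion, Finset.mem_erase, List.mem_toFinset]
    exact ⟨ℓ, by simp [L, hℓ, hdeg], hvr, hsub (P v).end_mem_support⟩
  calc ∑ v ∈ Finset.univ.erase r, x v
      ≤ ∑ v ∈ L.biUnion fun ℓ => (P ℓ).support.toFinset.erase r, x v :=
        Finset.sum_le_sum_of_subset_of_nonneg hcover fun v _ _ => hx v
    _ ≤ ∑ ℓ ∈ L, ∑ v ∈ (P ℓ).support.toFinset.erase r, x v :=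
        Finset.sum_biUnion_le_sum_sum_of_nonneg hx
    _ ≤ ∑ ℓ ∈ L, 1 :=
        Finset.sum_le_sum fun ℓ hℓ => hle ℓ (Finset.mem_filter.mp hℓ).2 (P ℓ) (hP ℓ)
    _ = (L.card : ℝ) := by simp
end

section
/- Triangle number of the Fano-plane connectivity pattern: Let M be the 7×7 pattern whose rows (with * marked and 0 elsewhere) are (*,0,0,0,*,*,*), (0,*,0,*,0,*,*), (0,0,*,*,*,0,*), (0,*,*,0,*,*,0), (*,0,*,*,0,*,0), (*,*,0,*,*,0,0), (*,*,*,0,0,0,*). Then tri(M) = 3: there exist injections ρ, σ : [3] → [7] with M(ρ(i),σ(i)) = * for all i and M(ρ(i),σ(j)) = 0 whenever i < j, and no such pair of injections exists for D = 4. -/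
/-- The 7×7 Fano-plane connectivity pattern (`true` = `*`, `false` = `0`). -/
def fanoPattern : Fin 7 → Fin 7 → Bool :=
  ![![true, false, false, false, true, true, true],
    ![false, true, false, true, false, true, true],
    ![false, false, true, true, true, false, true],
    ![false, true, true, false, true, true, false],
    ![true, false, true, true, false, true, false],
    ![true, true, false, true, true, false, false],
    ![true, true, true, false, false, false, true]]

/-- `M` contains a `D`-triangular matrix: there are injections `ρ, σ : [D] → [7]` with
`M(ρ i, σ i) = *` for all `i` and `M(ρ i, σ j) = 0` whenever `i < j`. -/
def containsTriangular (M : Fin 7 → Fin 7 → Bool) (D : ℕ) : Prop :=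
  ∃ ρ σ : Fin D → Fin 7, Function.Injective ρ ∧ Function.Injective σ ∧
    (∀ i : Fin D, M (ρ i) (σ i) = true) ∧
    (∀ i j : Fin D, i < j → M (ρ i) (σ j) = false)

/-- Two distinct rows of the Fano pattern have at most one common zero. -/
theorem fanoPattern_common_zero_unique :
    ∀ r s : Fin 7, r ≠ s → ∀ a b : Fin 7,
      fanoPattern r a = false → fanoPattern r b = false →
      fanoPattern s a = false → fanoPattern s b = false → a = b := by
  decide +kernel

/-- **Triangle number of the Fano-plane connectivity pattern**: `tri(M) = 3`, i.e. the
pattern contains a 3-triangular matrix but no 4-triangular matrix. -/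
theorem fano_triangle_number :
    containsTriangular fanoPattern 3 ∧ ¬ containsTriangular fanoPattern 4 := by
  constructor
  · exact ⟨![0, 1, 2], ![0, 1, 2], by decide, by decide, by decide, by decide⟩
  · rintro ⟨ρ, σ, hρ, hσ, -, hzero⟩
    have hrows : ρ 0 ≠ ρ 1 := hρ.ne (by decide)
    have hcols : σ 2 ≠ σ 3 := hσ.ne (by decide)
    exact hcols (fanoPattern_common_zero_unique _ _ hrows _ _
      (hzero 0 2 (by decide)) (hzero 0 3 (by decide))
      (hzero 1 2 (by decide)) (hzero 1 3 (by decide)))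
end

section
/- Minrank of the Fano-plane connectivity pattern over finite fields: Let M be the 7×7 pattern whose rows (with * marked and 0 elsewhere) are (*,0,0,0,*,*,*), (0,*,0,*,0,*,*), (0,0,*,*,*,0,*), (0,*,*,0,*,*,0), (*,0,*,*,0,*,0), (*,*,0,*,*,0,0), (*,*,*,0,0,0,*). For every finite field F of characteristic 2, minrk_F(M) = 3, i.e., there exists a 7×7 matrix over F fitting M of rank 3 and every matrix over F fitting M has rank at least 3. For every finite field F of odd characteristic, minrk_F(M) = 4, i.e., there exists a matrix over F fitting M of rank 4 and every matrix over F fitting M has rank at least 4. -/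
/-- A matrix `A` over a field fits the pattern: nonzero entries exactly at the `*`'s. -/
def fitsPattern {F : Type} [Field F] (A : Matrix (Fin 7) (Fin 7) F) : Prop :=
  ∀ i j, A i j ≠ 0 ↔ fanoPattern i j = true

/-- A nonvanishing `n × n` minor bounds the rank from below by `n`. -/
theorem le_rank_of_det_submatrix_ne_zero {F ι κ : Type*} [Field F] [Fintype ι] [Fintype κ] {n : ℕ}
    (A : Matrix ι κ F) (r : Fin n → ι) (c : Fin n → κ) (h : (A.submatrix r c).det ≠ 0) :
    n ≤ A.rank := by
  have hr : (A.submatrix r c).rank = n := by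
    simpa using Matrix.rank_of_det_ne_zero h
  exact hr ▸ Matrix.rank_submatrix_le A r c

/-- A matrix of rank at most three is determined by its rows and columns through an invertible
diagonal `3 × 3` block: the Schur complement of that block vanishes. -/
theorem schur_complement_eq_zero_of_rank_lt_four {F : Type} [Field F]
    {A : Matrix (Fin 7) (Fin 7) F} (hA : fitsPattern A) (hr : A.rank < 4) (i j : Fin 7) :
    A 0 0 * A 1 1 * A 2 2 * A i j =
      A i 0 * A 0 j * A 1 1 * A 2 2 + A i 1 * A 1 j * A 0 0 * A 2 2
        + A i 2 * A 2 j * A 0 0 * A 1 1 := by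
  have hdet : (A.submatrix ![0, 1, 2, i] ![0, 1, 2, j]).det = 0 := by
    by_contra h
    exact absurd (le_rank_of_det_submatrix_ne_zero A _ _ h) (by omega)
  have hz (a b : Fin 7) (h : fanoPattern a b = false) : A a b = 0 := by
    by_contra h0
    simp [(hA a b).1 h0] at h
  simp [-Matrix.submatrix_cons_row, Matrix.det_succ_row_zero, Fin.sum_univ_succ, Fin.succAbove,
    hz 0 1 rfl, hz 0 2 rfl, hz 1 0 rfl, hz 1 2 rfl, hz 2 0 rfl, hz 2 1 rfl] at hdet
  linear_combination hdet

theorem three_le_rank_of_fitsPattern {F : Type} [Field F] {A : Matrix (Fin 7) (Fin 7) F}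
    (hA : fitsPattern A) : 3 ≤ A.rank := by
  have hz (a b : Fin 7) (h : fanoPattern a b = false) : A a b = 0 := by
    by_contra h0
    simp [(hA a b).1 h0] at h
  apply le_rank_of_det_submatrix_ne_zero A ![0, 1, 2] ![0, 1, 2]
  simp [-Matrix.submatrix_cons_row, Matrix.det_fin_three, hz 0 1 rfl, hz 0 2 rfl, hz 1 0 rfl,
    hz 1 2 rfl, hz 2 0 rfl,
    (hA 0 0).2 rfl, (hA 1 1).2 rfl, (hA 2 2).2 rfl]

/-- If the coefficients `p, q` annihilate both `(d, g)` and `(f, k)`, then these two vectors are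
proportional, so any `y, z` annihilating `(d, g)` also annihilates `(f, k)`. -/
theorem annihilate_of_common_annihilator {F : Type*} [Field F] {p q d g f k y z : F}
    (hq : q ≠ 0) (hd : d ≠ 0) (h₁ : p * d + q * g = 0) (h₂ : p * f + q * k = 0)
    (h₃ : y * d + z * g = 0) : y * f + z * k = 0 := by
  have : q * d * (y * f + z * k) = 0 := by
    linear_combination q * f * h₃ + z * d * h₂ - z * f * h₁
  simpa [hq, hd] using this

theorem four_le_rank_of_fitsPattern {F : Type} [Field F] (h2 : (2 : F) ≠ 0)
    {A : Matrix (Fin 7) (Fin 7) F} (hA : fitsPattern A) : 4 ≤ A.rank := by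
  by_contra! hr
  have hz (a b : Fin 7) (h : fanoPattern a b = false) : A a b = 0 := by
    by_contra h0
    simp [(hA a b).1 h0] at h
  have hn (a b : Fin 7) (h : fanoPattern a b = true) : A a b ≠ 0 := (hA a b).2 h
  have hs := schur_complement_eq_zero_of_rank_lt_four hA hr
  have h₀ := hn 0 0 rfl
  have h₁ := hn 1 1 rfl
  have h₂ := hn 2 2 rfl
  have rel₁₂ (i j : Fin 7) (hi : A i 0 * A 0 j = 0) (hij : A i j = 0) :
      A i 1 * A 2 2 * A 1 j + A i 2 * A 1 1 * A 2 j = 0 := by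
    apply mul_left_cancel₀ h₀
    linear_combination -hs i j + A 0 0 * A 1 1 * A 2 2 * hij - A 1 1 * A 2 2 * hi
  have rel₀₂ (i j : Fin 7) (hi : A i 1 * A 1 j = 0) (hij : A i j = 0) :
      A i 0 * A 2 2 * A 0 j + A i 2 * A 0 0 * A 2 j = 0 := by
    apply mul_left_cancel₀ h₁
    linear_combination -hs i j + A 0 0 * A 1 1 * A 2 2 * hij - A 0 0 * A 2 2 * hi
  have rel₀₁ (i j : Fin 7) (hi : A i 2 * A 2 j = 0) (hij : A i j = 0) :
      A i 0 * A 1 1 * A 0 j + A i 1 * A 0 0 * A 1 j = 0 := by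
    apply mul_left_cancel₀ h₂
    linear_combination -hs i j + A 0 0 * A 1 1 * A 2 2 * hij - A 0 0 * A 1 1 * hi
  have e₁₂ := annihilate_of_common_annihilator (mul_ne_zero (hn 3 2 rfl) h₁) (hn 1 3 rfl)
    (rel₁₂ 3 3 (by simp [hz 3 0 rfl]) (hz 3 3 rfl))
    (rel₁₂ 3 6 (by simp [hz 3 0 rfl]) (hz 3 6 rfl))
    (rel₁₂ 6 3 (by simp [hz 0 3 rfl]) (hz 6 3 rfl))
  have e₀₂ := annihilate_of_common_annihilator (mul_ne_zero (hn 4 2 rfl) h₀) (hn 0 4 rfl)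
    (rel₀₂ 4 4 (by simp [hz 4 1 rfl]) (hz 4 4 rfl))
    (rel₀₂ 4 6 (by simp [hz 4 1 rfl]) (hz 4 6 rfl))
    (rel₀₂ 6 4 (by simp [hz 1 4 rfl]) (hz 6 4 rfl))
  have e₀₁ := annihilate_of_common_annihilator (mul_ne_zero (hn 5 1 rfl) h₀) (hn 0 5 rfl)
    (rel₀₁ 5 5 (by simp [hz 5 2 rfl]) (hz 5 5 rfl))
    (rel₀₁ 5 6 (by simp [hz 5 2 rfl]) (hz 5 6 rfl))
    (rel₀₁ 6 5 (by simp [hz 2 5 rfl]) (hz 6 5 rfl))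
  have : 2 * (A 6 0 * A 0 6 * A 1 1 * A 2 2) = 0 := by
    linear_combination A 1 1 * e₀₂ + A 2 2 * e₀₁ - A 0 0 * e₁₂
  simp [h2, hn 6 0 rfl, hn 0 6 rfl, h₁, h₂] at this

/-- The matrix whose first three rows are `0/1`, whose next three rows are differences of these,
and whose last row is the `0/1` row of the pattern. -/
def fanoMatrix (F : Type*) [Field F] : Matrix (Fin 7) (Fin 7) F :=
  !![1, 0, 0, 0, 1, 1, 1;
     0, 1, 0, 1, 0, 1, 1;
     0, 0, 1, 1, 1, 0, 1;
     0, 1, -1, 0, -1, 1, 0;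
     1, 0, -1, -1, 0, 1, 0;
     1, -1, 0, -1, 1, 0, 0;
     1, 1, 1, 0, 0, 0, 1]

theorem fitsPattern_fanoMatrix (F : Type) [Field F] : fitsPattern (fanoMatrix F) := by
  intro i j
  fin_cases i <;> fin_cases j <;> simp [fanoMatrix, fanoPattern]

theorem rank_fanoMatrix_le_four (F : Type*) [Field F] : (fanoMatrix F).rank ≤ 4 := by
  have h : fanoMatrix F =
      (!![1, 0, 0, 0; 0, 1, 0, 0; 0, 0, 1, 0; 0, 1, -1, 0; 1, 0, -1, 0; 1, -1, 0, 0; 0, 0, 0, 1] :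
        Matrix (Fin 7) (Fin 4) F) *
      (!![1, 0, 0, 0, 1, 1, 1; 0, 1, 0, 1, 0, 1, 1; 0, 0, 1, 1, 1, 0, 1; 1, 1, 1, 0, 0, 0, 1] :
        Matrix (Fin 4) (Fin 7) F) := by
    ext i j
    fin_cases i <;> fin_cases j <;> simp [fanoMatrix, Matrix.mul_apply, Fin.sum_univ_succ]
  rw [h]
  exact (Matrix.rank_mul_le_left _ _).trans (Matrix.rank_le_width _)

theorem rank_fanoMatrix_le_three (F : Type*) [Field F] (h2 : (2 : F) = 0) :
    (fanoMatrix F).rank ≤ 3 := by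
  have h11 : (1 : F) + 1 = 0 := one_add_one_eq_two.trans h2
  have h : fanoMatrix F =
      (!![1, 0, 0; 0, 1, 0; 0, 0, 1; 0, 1, -1; 1, 0, -1; 1, -1, 0; 1, 1, 1] :
        Matrix (Fin 7) (Fin 3) F) *
      (!![1, 0, 0, 0, 1, 1, 1; 0, 1, 0, 1, 0, 1, 1; 0, 0, 1, 1, 1, 0, 1] :
        Matrix (Fin 3) (Fin 7) F) := by
    ext i j
    fin_cases i <;> fin_cases j <;>
      simp [fanoMatrix, Matrix.mul_apply, Fin.sum_univ_succ, h11]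
  rw [h]
  exact (Matrix.rank_mul_le_left _ _).trans (Matrix.rank_le_width _)

/-- **Minrank of the Fano-plane connectivity pattern over finite fields**: over every finite
field of characteristic 2 the minrank is 3, and over every finite field of odd
characteristic the minrank is 4. -/
theorem fano_minrank (F : Type) [Field F] [Fintype F] :
    (ringChar F = 2 →
      (∃ A : Matrix (Fin 7) (Fin 7) F, fitsPattern A ∧ A.rank = 3) ∧
      (∀ A : Matrix (Fin 7) (Fin 7) F, fitsPattern A → 3 ≤ A.rank)) ∧
    (ringChar F ≠ 2 →
      (∃ A : Matrix (Fin 7) (Fin 7) F, fitsPattern A ∧ A.rank = 4) ∧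
      (∀ A : Matrix (Fin 7) (Fin 7) F, fitsPattern A → 4 ≤ A.rank)) := by
  refine ⟨fun hF => ?_, fun hF => ?_⟩
  · have h2 : (2 : F) = 0 := by
      exact_mod_cast (ringChar.spec F 2).2 hF.dvd
    exact ⟨⟨fanoMatrix F, fitsPattern_fanoMatrix F, (rank_fanoMatrix_le_three F h2).antisymm
      (three_le_rank_of_fitsPattern (fitsPattern_fanoMatrix F))⟩,
      fun _ => three_le_rank_of_fitsPattern⟩
  · have h2 : (2 : F) ≠ 0 := Ring.two_ne_zero hF
    exact ⟨⟨fanoMatrix F, fitsPattern_fanoMatrix F, (rank_fanoMatrix_le_four F).antisymm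
      (four_le_rank_of_fitsPattern h2 (fitsPattern_fanoMatrix F))⟩,
      fun _ => four_le_rank_of_fitsPattern h2⟩
end
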